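/- arXiv:2402.01500 — 9 statements merged into one kernel-verified Lean document; each statement's English description precedes it below -/
import Mathlib

section
/- Let M be a finite unitary magma with m := #M. For every n ≥ 2, the number of noncrossing M-cliques of arity n equals Σ_{k=0}^{n−2} m^{n+k+1} · (m−1)^{n−k−2} · nar(n,k). -/
/-! Noncrossing `M`-cliques for a unitary magma `M` (modeled as `MulOneClass`),
and the algebraic equation satisfied by their generating series. -/

/-- An arc of a polygon with `n+1` vertices (0-indexed vertices `0,…,n`),
given by a pair of vertices `x < y`.  For an `M`-clique of arity `n`,
this corresponds to the arcs `(x,y)` with `1 ≤ x < y ≤ n+1` (1-indexed). -/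
def Arc (n : ℕ) : Type := {a : Fin (n + 1) × Fin (n + 1) // a.1 < a.2}

/-- An `M`-clique of arity `n`: a labeling of all arcs by elements of `M`. -/
def CliqueLab (M : Type) (n : ℕ) : Type := Arc n → M

namespace Arc

/-- The base: the arc `(0, n)` (0-indexed), i.e. `(1, n+1)` (1-indexed). -/
def IsBase {n : ℕ} (a : Arc n) : Prop := (a.val.1 : ℕ) = 0 ∧ (a.val.2 : ℕ) = n

/-- The edges: the arcs `(i, i+1)`. -/
def IsEdge {n : ℕ} (a : Arc n) : Prop := (a.val.2 : ℕ) = (a.val.1 : ℕ) + 1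

/-- A diagonal: an arc which is neither the base nor an edge. -/
def IsDiagonal {n : ℕ} (a : Arc n) : Prop := ¬ a.IsBase ∧ ¬ a.IsEdge

/-- Two arcs cross if `x < x' < y < y'` or `x' < x < y' < y`. -/
def Cross {n : ℕ} (a b : Arc n) : Prop :=
  ((a.val.1 : ℕ) < (b.val.1 : ℕ) ∧ (b.val.1 : ℕ) < (a.val.2 : ℕ) ∧
      (a.val.2 : ℕ) < (b.val.2 : ℕ)) ∨
  ((b.val.1 : ℕ) < (a.val.1 : ℕ) ∧ (a.val.1 : ℕ) < (b.val.2 : ℕ) ∧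
      (b.val.2 : ℕ) < (a.val.2 : ℕ))

end Arc

/-- An `M`-clique is noncrossing if no two of its solid diagonals cross. -/
def Noncrossing {M : Type} [One M] {n : ℕ} (p : CliqueLab M n) : Prop :=
  ∀ a b : Arc n, a.IsDiagonal → b.IsDiagonal → p a ≠ 1 → p b ≠ 1 → ¬ a.Cross b

/-- The type of noncrossing `M`-cliques of arity `n`.  By convention there is exactly
one noncrossing `M`-clique of arity `1`: the unit clique, whose only arc is labeled
by the unit of `M`. -/
def NCClique (M : Type) [One M] (n : ℕ) : Type :=
  {p : CliqueLab M n // Noncrossing p ∧ (n = 1 → ∀ a, p a = 1)}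

/-- The number of noncrossing `M`-cliques of arity `n`. -/
noncomputable def ncCount (M : Type) [One M] (n : ℕ) : ℕ := Nat.card (NCClique M n)

/-- The Narayana number `nar(n,k) = (1/(n−1))·binom(n−1,k)·binom(n−1,k+1)`. -/
def nar (n k : ℕ) : ℕ := (n - 1).choose k * (n - 1).choose (k + 1) / (n - 1)

/-- `p` is a labeling of the arcs of the polygon with vertices `a, …, b` (extended by `1` to all
pairs of naturals) without crossing solid arcs, and with base label in `B`. Edges and the base
never cross another arc, so there is no need to single out the diagonals. -/
def IsNC {M : Type} [One M] (a b : ℕ) (B : Set M) (p : ℕ → ℕ → M) : Prop :=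
  (∀ x y, p x y ≠ 1 → a ≤ x ∧ x < y ∧ y ≤ b) ∧
    (∀ x y x' y', p x y ≠ 1 → p x' y' ≠ 1 → x < x' → x' < y → y < y' → False) ∧ p a b ∈ B

namespace IsNC
variable {M : Type} [One M]

theorem card_shift (a b d : ℕ) (B : Set M) :
    Nat.card {p // IsNC (a + d) (b + d) B p} = Nat.card {p // IsNC a b B p} := by
  classical
  refine Nat.card_congr
    { toFun := fun p => ⟨fun x y => p.1 (x + d) (y + d), ?_⟩
      invFun := fun q => ⟨fun x y => if d ≤ x ∧ d ≤ y then q.1 (x - d) (y - d) else 1, ?_⟩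
      left_inv := ?_
      right_inv := ?_ }
  · obtain ⟨p, h1, h2, h3⟩ := p
    refine ⟨fun x y h => ?_, fun x y x' y' h h' i j k => ?_, h3⟩
    · have := h1 _ _ h
      omega
    · exact h2 _ _ _ _ h h' (by omega) (by omega) (by omega)
  · obtain ⟨p, h1, h2, h3⟩ := q
    refine ⟨fun x y h => ?_, fun x y x' y' h h' i j k => ?_, by simpa using h3⟩
    · simp only [ne_eq, ite_eq_right_iff, not_forall] at h
      obtain ⟨h, h'⟩ := h
      have := h1 _ _ h'
      omega
    · simp only [ne_eq, ite_eq_right_iff, not_forall] at h h'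
      obtain ⟨h, g⟩ := h
      obtain ⟨h', g'⟩ := h'
      exact h2 _ _ _ _ g g' (by omega) (by omega) (by omega)
  · rintro ⟨p, h1, h2, h3⟩
    ext x y
    simp only
    split_ifs with h
    · rw [Nat.sub_add_cancel h.1, Nat.sub_add_cancel h.2]
    · by_contra hne
      have := h1 x y (Ne.symm hne)
      omega
  · rintro ⟨p, h1, h2, h3⟩
    ext x y
    simp

theorem card_base {a b : ℕ} (hab : a < b) (B : Set M) :
    Nat.card {p // IsNC a b B p} = Nat.card B * Nat.card {p // IsNC a b ({1} : Set M) p} := by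
  classical
  rw [← Nat.card_prod]
  refine Nat.card_congr
    { toFun := fun p => ⟨⟨p.1 a b, p.2.2.2⟩, fun x y => if x = a ∧ y = b then 1 else p.1 x y, ?_⟩
      invFun := fun q => ⟨fun x y => if x = a ∧ y = b then q.1.1 else q.2.1 x y, ?_⟩
      left_inv := ?_
      right_inv := ?_ }
  · obtain ⟨p, h1, h2, h3⟩ := p
    refine ⟨fun x y h => ?_, fun x y x' y' h h' i j k => ?_, by simp⟩
    · dsimp only at h
      split_ifs at h
      · exact absurd rfl h
      · exact h1 _ _ h
    · dsimp only at h h'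
      split_ifs at h h' <;>
        first | exact absurd rfl h | exact absurd rfl h' | exact h2 _ _ _ _ h h' i j k
  · obtain ⟨⟨m, hm⟩, p, h1, h2, h3⟩ := q
    refine ⟨fun x y h => ?_, fun x y x' y' h h' i j k => ?_, by simpa⟩
    · dsimp only at h
      split_ifs at h
      · omega
      · exact h1 _ _ h
    · dsimp only at h h'
      split_ifs at h h' with u v v
      · omega
      · have := h1 _ _ h'
        omega
      · have := h1 _ _ h
        omega
      · exact h2 _ _ _ _ h h' i j k
  · rintro ⟨p, h1, h2, h3⟩
    ext x y
    simp only
    split_ifs with h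
    · rw [h.1, h.2]
    · rfl
  · rintro ⟨⟨m, hm⟩, p, h1, h2, h3⟩
    ext x y
    · simp
    simp only
    split_ifs with h
    · rw [h.1, h.2]
      exact (Set.mem_singleton_iff.1 h3).symm
    · rfl

/-- Noncrossing labelings for which `(0, j)` is the last arc `(0, i)`, `i < n`, having a label in
`A` split into a base label, a labeling of `0, …, j`, and a labeling of `j, …, n`. -/
theorem card_split {j n : ℕ} (hj : 1 ≤ j) (hjn : j < n) (A B : Set M) (hA : 2 ≤ j → 1 ∉ A) :
    Nat.card {p // IsNC 0 n B p ∧ p 0 j ∈ A ∧ ∀ i, j < i → i < n → p 0 i = 1} =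
      Nat.card B * (Nat.card {p // IsNC 0 j A p} * Nat.card {p // IsNC j n (Set.univ : Set M) p}) := by
  classical
  rw [← Nat.card_prod, ← Nat.card_prod]
  refine Nat.card_congr
    { toFun := fun p => ⟨⟨p.1 0 n, p.2.1.2.2⟩, ⟨fun x y => if y ≤ j then p.1 x y else 1, ?_⟩,
        ⟨fun x y => if j ≤ x then p.1 x y else 1, ?_⟩⟩
      invFun := fun q => ⟨fun x y => if x = 0 ∧ y = n then q.1.1 else
        if y ≤ j then q.2.1.1 x y else if j ≤ x then q.2.2.1 x y else 1, ?_⟩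
      left_inv := ?_
      right_inv := ?_ }
  · obtain ⟨p, ⟨h1, h2, h3⟩, h4, h5⟩ := p
    refine ⟨fun x y h => ?_, fun x y x' y' h h' i k l => ?_, by simpa⟩
    · dsimp only at h
      split_ifs at h with u
      · have := h1 _ _ h
        omega
      · simp at h
    · dsimp only at h h'
      split_ifs at h h' with u v v
      · exact h2 _ _ _ _ h h' i k l
      all_goals simp_all
  · obtain ⟨p, ⟨h1, h2, h3⟩, h4, h5⟩ := p
    refine ⟨fun x y h => ?_, fun x y x' y' h h' i k l => ?_, by simp⟩
    · dsimp only at h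
      split_ifs at h with u
      · have := h1 _ _ h
        omega
      · simp at h
    · dsimp only at h h'
      split_ifs at h h' with u v v
      · exact h2 _ _ _ _ h h' i k l
      all_goals simp_all
  · obtain ⟨⟨m, hm⟩, ⟨p, h1, h2, h3⟩, q, g1, g2, g3⟩ := q
    refine ⟨⟨fun x y h => ?_, fun x y x' y' h h' i k l => ?_, by simpa⟩, ?_, fun i hi hi' => ?_⟩
    · dsimp only at h
      split_ifs at h with u v w
      · omega
      · have := h1 _ _ h
        omega
      · have := g1 _ _ h
        omega
      · simp at h
    · have key : ∀ x y, (if x = 0 ∧ y = n then m else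
          if y ≤ j then p x y else if j ≤ x then q x y else 1) ≠ 1 →
          (x = 0 ∧ y = n) ∨ (p x y ≠ 1 ∧ x < y ∧ y ≤ j) ∨ (q x y ≠ 1 ∧ j ≤ x ∧ x < y ∧ y ≤ n) := by
        intro x y h
        split_ifs at h with u v w
        · exact .inl u
        · have := h1 _ _ h
          exact .inr (.inl ⟨h, this.2⟩)
        · exact .inr (.inr ⟨h, g1 _ _ h⟩)
        · simp at h
      have e := key _ _ h
      have e' := key _ _ h'
      rcases e with e | e | e <;> rcases e' with e' | e' | e'
      all_goals first | omega | exact h2 _ _ _ _ e.1 e'.1 i k l | exact g2 _ _ _ _ e.1 e'.1 i k l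
    · have : j ≠ n := by omega
      simpa [this]
    · have h1 : i ≠ n := by omega
      have h2 : ¬ i ≤ j := by omega
      simp [h1, h2]
      omega
  · rintro ⟨p, ⟨h1, h2, h3⟩, h4, h5⟩
    ext x y
    simp only
    split_ifs with u v w
    · rw [u.1, u.2]
    · rfl
    · rfl
    · by_contra hne
      have hne := Ne.symm hne
      have := h1 _ _ hne
      rcases Nat.eq_zero_or_pos x with rfl | hx
      · exact hne (h5 y (by omega) (by omega))
      · refine h2 0 j x y (fun h => hA (by omega) (h ▸ h4)) hne hx (by omega) (by omega)
  · rintro ⟨⟨m, hm⟩, ⟨p, h1, h2, h3⟩, q, g1, g2, g3⟩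
    ext x y
    · simp
    · simp only
      split_ifs with u v
      · omega
      · rfl
      · by_contra hne
        have := h1 _ _ (Ne.symm hne)
        omega
    · simp only
      split_ifs with u v w
      · omega
      · by_contra hne
        have h := h1 x y
        have := g1 x y
        grind
      · rfl
      · by_contra hne
        have := g1 _ _ (Ne.symm hne)
        omega

instance [Finite M] (a b : ℕ) (B : Set M) : Finite {p // IsNC a b B p} := by
  refine Finite.of_injective
    (fun p (x y : Fin (b + 1)) => p.1 x y) fun p q h => Subtype.ext (funext₂ fun x y => ?_)
  by_cases hxy : x < b + 1 ∧ y < b + 1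
  · exact congr_fun₂ h ⟨x, hxy.1⟩ ⟨y, hxy.2⟩
  · have outside : ∀ r : {p // IsNC a b B p}, r.1 x y = 1 := fun r => by
      by_contra h
      have := r.2.1 x y h
      omega
    rw [outside p, outside q]

theorem card_eq {a b : ℕ} (hab : a < b) (B : Set M) :
    Nat.card {p // IsNC a b B p} =
      Nat.card B * Nat.card {p // IsNC 0 (b - a) ({1} : Set M) p} := by
  rw [card_base hab, ← card_shift 0 (b - a) a, Nat.zero_add, Nat.sub_add_cancel hab.le]

variable (M) in
theorem card_one : Nat.card {p // IsNC 0 1 ({1} : Set M) p} = 1 := by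
  rw [Nat.card_eq_one_iff_unique]
  refine ⟨⟨fun p q => Subtype.ext (funext₂ fun x y => ?_)⟩,
    ⟨fun _ _ => 1, by simp, by simp, by simp⟩⟩
  have trivial_label : ∀ r : {p // IsNC 0 1 ({1} : Set M) p}, r.1 x y = 1 := fun r => by
    by_contra h
    have := r.2.1 x y h
    obtain ⟨rfl, rfl⟩ : x = 0 ∧ y = 1 := by omega
    exact h r.2.2.2
  rw [trivial_label p, trivial_label q]

theorem _root_.Nat.card_eq_sum_card_fiber {α β : Type*} [Finite α] (f : α → β) (s : Finset β)
    (h : ∀ x, f x ∈ s) : Nat.card α = ∑ j ∈ s, Nat.card {x // f x = j} := by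
  classical
  have := Fintype.ofFinite α
  rw [Nat.card_eq_fintype_card, ← Finset.card_univ,
    Finset.card_eq_sum_card_fiberwise (f := f) (t := s) fun x _ => h x]
  exact Finset.sum_congr rfl fun j _ => by rw [Nat.card_eq_fintype_card, Fintype.card_subtype]

variable (M) in
/-- Recurrence for noncrossing labelings with unit base, by the last solid arc `(0, j + 1)`
(the edge `(0, 1)` counting as solid). -/
theorem card_rec [Fintype M] (n : ℕ) :
    Nat.card {p // IsNC 0 (n + 2) ({1} : Set M) p} =
      ∑ j ∈ Finset.range (n + 1),
        (if j = 0 then Fintype.card M else Fintype.card M - 1) *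
          Nat.card {p // IsNC 0 (j + 1) ({1} : Set M) p} *
          (Fintype.card M * Nat.card {p // IsNC 0 (n + 1 - j) ({1} : Set M) p}) := by
  classical
  rw [Nat.card_eq_sum_card_fiber (s := Finset.range (n + 1)) (fun p : {p // IsNC 0 (n + 2) {1} p} =>
    Nat.findGreatest (fun j => j = 0 ∨ p.1 0 (j + 1) ≠ (1 : M)) n)
    fun p => Finset.mem_range_succ_iff.2 (Nat.findGreatest_le n)]
  refine Finset.sum_congr rfl fun j hj => ?_
  rw [Finset.mem_range] at hj
  let L : Set M := {x | j = 0 ∨ x ≠ 1}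
  have hL : Nat.card L = if j = 0 then Fintype.card M else Fintype.card M - 1 := by
    split_ifs with h
    · simp [L, h]
    · have : L = {1}ᶜ := by ext; simp [L, h]
      rw [this, Nat.card_eq_fintype_card, Fintype.card_compl_set]
      simp
  have hsplit := card_split (j := j + 1) (n := n + 2) (by omega) (by omega) L ({1} : Set M)
    (fun h => by simp [L]; omega)
  rw [card_eq (by omega) L, card_eq (by omega) Set.univ, hL, Nat.card_univ] at hsplit
  have hone : Nat.card ({1} : Set M) = 1 := by simp
  rw [hone, one_mul, Nat.card_eq_fintype_card (α := M), Nat.sub_zero,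
    show n + 2 - (j + 1) = n + 1 - j by omega] at hsplit
  rw [← hsplit]
  refine Nat.card_congr ((Equiv.subtypeSubtypeEquivSubtypeInter (IsNC 0 (n + 2) {1})
    fun p => Nat.findGreatest (fun j => j = 0 ∨ p 0 (j + 1) ≠ (1 : M)) n = j).trans
    (Equiv.subtypeEquivRight fun p => and_congr_right fun _ => ?_))
  rw [Nat.findGreatest_eq_iff]
  constructor
  · rintro ⟨-, h1, h2⟩
    refine ⟨?_, fun i hi hi' => ?_⟩
    · by_cases h : j = 0
      · exact .inl h
      · exact h1 h
    · have := @h2 (i - 1) (by omega) (by omega)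
      rw [Nat.sub_add_cancel (by omega)] at this
      tauto
  · rintro ⟨h1, h2⟩
    refine ⟨by omega, fun _ => h1, fun i hi hi' h => ?_⟩
    have := h2 (i + 1) (by omega) (by omega)
    have : i ≠ 0 := by omega
    tauto

end IsNC

theorem ncCount_eq (M : Type) [One M] [Finite M] {n : ℕ} (hn : 2 ≤ n) :
    ncCount M n = Nat.card {p // IsNC 0 n (Set.univ : Set M) p} := by
  classical
  refine Nat.card_congr
    { toFun := fun p => ⟨fun x y => if h : x < y ∧ y < n + 1 then
        p.1 ⟨(⟨x, by omega⟩, ⟨y, h.2⟩), h.1⟩ else 1, ?_⟩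
      invFun := fun q => ⟨fun a => q.1 a.1.1 a.1.2, ?_⟩
      left_inv := ?_
      right_inv := ?_ }
  · obtain ⟨p, hp, -⟩ := p
    refine ⟨fun x y h => ?_, fun x y x' y' h h' i j k => ?_, trivial⟩
    · dsimp only at h
      split_ifs at h
      · omega
      · simp at h
    · dsimp only at h h'
      split_ifs at h h' with u v v
      · refine hp _ _ ?_ ?_ h h' (.inl ⟨i, j, k⟩) <;>
          simp only [Arc.IsDiagonal, Arc.IsBase, Arc.IsEdge] <;> omega
      all_goals simp at h h'
  · obtain ⟨q, h1, h2, h3⟩ := q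
    refine ⟨fun a b _ _ ha hb hab => ?_, by omega⟩
    rcases hab with ⟨i, j, k⟩ | ⟨i, j, k⟩
    · exact h2 _ _ _ _ ha hb i j k
    · exact h2 _ _ _ _ hb ha i j k
  · rintro ⟨p, hp, h⟩
    refine Subtype.ext (funext fun ⟨⟨⟨x, hx⟩, ⟨y, hy⟩⟩, hxy⟩ => ?_)
    have : x < y := hxy
    simp [this, hy]
  · rintro ⟨q, h1, h2, h3⟩
    ext x y
    simp only
    split_ifs with h
    · rfl
    · by_contra hne
      have := h1 x y (Ne.symm hne)
      omega

open PowerSeries in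
/-- Lagrange inversion for the solution of `y = X (1 + c y + d y ^ 2)`. -/
theorem PowerSeries.natCast_mul_coeff_pow_of_eq_X_mul_quadratic (c d : ℚ) (y : PowerSeries ℚ)
    (hy : y = X * (1 + C c * y + C d * y ^ 2)) (a r : ℕ) :
    (a : ℚ) * coeff a (y ^ r) = r * coeff a (X ^ r * (1 + C c * X + C d * X ^ 2) ^ a) := by
  have hXd : ∀ (a : ℕ) (f : PowerSeries ℚ), coeff a (X * derivative ℚ f) = a * coeff a f := by
    rintro (_ | a) f
    · simp
    · rw [coeff_succ_X_mul, coeff_derivative]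
      push_cast
      ring
  have hy0 : constantCoeff y = 0 := by rw [hy]; simp
  induction a generalizing r with
  | zero => cases r <;> simp
  | succ a ih =>
    obtain _ | r := r
    · simp [coeff_one]
    have hpow : y ^ (r + 1) = X * (y ^ r + C c * y ^ (r + 1) + C d * y ^ (r + 2)) := by
      calc y ^ (r + 1) = y ^ r * y := pow_succ _ _
        _ = y ^ r * (X * (1 + C c * y + C d * y ^ 2)) := by rw [← hy]
        _ = _ := by ring
    set φ : PowerSeries ℚ := 1 + C c * X + C d * X ^ 2 with hφ
    have hX : X ^ (r + 1) * φ ^ (a + 1) = X * (X ^ r * φ ^ (a + 1)) := by ring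
    rw [hpow, hX, coeff_succ_X_mul, coeff_succ_X_mul, map_add, map_add, coeff_C_mul, coeff_C_mul]
    obtain rfl | ha := Nat.eq_zero_or_pos a
    · cases r <;> simp [hy0, hφ]
    have hder : (X : PowerSeries ℚ) * derivative ℚ (X ^ r * φ ^ (a + 1)) =
        C (r : ℚ) * (X ^ r * φ ^ (a + 1)) +
          C ((a : ℚ) + 1) * (C c * (X ^ (r + 1) * φ ^ a) + C (2 * d) * (X ^ (r + 2) * φ ^ a)) := by
      have hdφ : derivative ℚ φ = C c + C (2 * d) * X := by
        have h2 : (C (2 * d) : PowerSeries ℚ) = 2 * C d := by simp [two_mul]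
        rw [h2]
        simp [hφ, derivative_C, derivative_X, Derivation.leibniz]
        ring
      rw [Derivation.leibniz, derivative_pow, derivative_pow, derivative_X, hdφ]
      simp only [map_add, map_one, map_natCast, smul_eq_mul, Nat.add_sub_cancel]
      obtain _ | r := r
      · push_cast
        ring
      · push_cast
        ring
    have h1 := congrArg (coeff a) hder
    have h2 : coeff a (X ^ r * φ ^ (a + 1)) = coeff a (X ^ r * φ ^ a) +
        c * coeff a (X ^ (r + 1) * φ ^ a) + d * coeff a (X ^ (r + 2) * φ ^ a) := by
      rw [← coeff_C_mul, ← coeff_C_mul, ← map_add, ← map_add]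
      congr 1
      rw [hφ]
      ring
    rw [hXd, map_add, coeff_C_mul, coeff_C_mul, map_add, coeff_C_mul, coeff_C_mul] at h1
    have i0 := ih r
    have i1 := ih (r + 1)
    have i2 := ih (r + 2)
    have ha' : (a : ℚ) ≠ 0 := by positivity
    apply mul_left_cancel₀ ha'
    push_cast at *
    linear_combination ((a : ℚ) + 1) * i0 + (a + 1) * c * i1 + (a + 1) * d * i2 - h1 - (a + 1) * r * h2


theorem Nat.dvd_choose_mul_choose_succ (n k : ℕ) : n ∣ n.choose k * n.choose (k + 1) := by
  obtain _ | n := n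
  · cases k <;> simp
  obtain hk | hk := lt_or_ge (n + 1) k
  · simp [Nat.choose_eq_zero_of_lt hk]
  have h1 : n + 1 ∣ (k + 1) * ((n + 1).choose k * (n + 1).choose (k + 1)) :=
    ⟨n.choose k * (n + 1).choose k, by
      rw [← mul_assoc (n + 1) (n.choose k), Nat.add_one_mul_choose_eq]
      ring⟩
  have h2 : n + 1 ∣ (n + 1 - k) * ((n + 1).choose k * (n + 1).choose (k + 1)) :=
    ⟨n.choose k * (n + 1).choose (k + 1), by
      rw [← mul_assoc, mul_comm (n + 1 - k), ← Nat.choose_mul_succ_eq]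
      ring⟩
  have h3 := dvd_add h1 h2
  rw [← add_mul, show k + 1 + (n + 1 - k) = n + 1 + 1 by omega, add_mul, one_mul] at h3
  exact (Nat.dvd_add_right (dvd_mul_right _ _)).1 h3

open PowerSeries in
theorem PowerSeries.coeff_one_add_C_mul_X_pow {R : Type*} [CommRing R] (t : R) (a k : ℕ) :
    coeff k ((1 + C t * X) ^ a) = a.choose k * t ^ k := by
  have : ((1 + C t * X) ^ a : PowerSeries R) = rescale t (((1 + Polynomial.X) ^ a : Polynomial R)) := by
    simp [rescale_X]
  rw [this, coeff_rescale, Polynomial.coeff_coe, Polynomial.coeff_one_add_X_pow, mul_comm]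

open PowerSeries in
/-- The coefficients of the solution of `y = X (1 + s y) (1 + t y)` are the homogenized Narayana
polynomials. -/
theorem coeff_eq_sum_nar (s t : ℚ) (y : PowerSeries ℚ)
    (hy : y = X * (1 + C (s + t) * y + C (s * t) * y ^ 2)) (n : ℕ) :
    coeff (n + 1) y = ∑ k ∈ Finset.range (n + 1), t ^ k * s ^ (n - k) * nar (n + 2) k := by
  have h := natCast_mul_coeff_pow_of_eq_X_mul_quadratic _ _ y hy (n + 1) 1
  have hφ : (1 + C (s + t) * X + C (s * t) * X ^ 2 : PowerSeries ℚ) =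
      (1 + C t * X) * (1 + C s * X) := by
    simp only [map_add, map_mul]
    ring
  rw [pow_one, pow_one, coeff_succ_X_mul, hφ, mul_pow, coeff_mul,
    Finset.Nat.sum_antidiagonal_eq_sum_range_succ_mk, Nat.cast_one, one_mul] at h
  have hn : ((n + 1 : ℕ) : ℚ) ≠ 0 := by positivity
  apply mul_left_cancel₀ hn
  rw [h, Finset.mul_sum]
  refine Finset.sum_congr rfl fun k hk => ?_
  rw [Finset.mem_range] at hk
  have hsymm : (n + 1).choose (n - k) = (n + 1).choose (k + 1) :=
    Nat.choose_symm_of_eq_add (by omega)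
  have hdvd := Nat.dvd_choose_mul_choose_succ (n + 1) k
  rw [coeff_one_add_C_mul_X_pow, coeff_one_add_C_mul_X_pow, hsymm, nar,
    show n + 2 - 1 = n + 1 from rfl, Nat.cast_div hdvd hn]
  field_simp
  push_cast
  ring

open PowerSeries in
/-- Solution of the convolution recurrence satisfied by noncrossing labelings with unit base. -/
theorem eq_sum_nar_of_rec (m : ℚ) (hm : m ≠ 0) (e : ℕ → ℚ) (h1 : e 1 = 1)
    (hrec : ∀ n, e (n + 2) = ∑ j ∈ Finset.range (n + 1),
      (if j = 0 then m else m - 1) * e (j + 1) * (m * e (n + 1 - j))) (n : ℕ) :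
    e (n + 2) = m ^ (n + 2) *
      ∑ k ∈ Finset.range (n + 1), m ^ k * (m - 1) ^ (n - k) * nar (n + 2) k := by
  let y : PowerSeries ℚ := PowerSeries.mk fun a => if a = 0 then 0 else e (a + 1) / m ^ (a + 1)
  have hy0 : coeff 0 y = 0 := by simp [y]
  have hyS : ∀ a, coeff (a + 1) y = e (a + 2) / m ^ (a + 2) := fun a => by simp [y]
  have hy : y = X * (1 + C (m - 1 + m) * y + C ((m - 1) * m) * y ^ 2) := by
    ext a
    obtain _ | a := a
    · simp [y]
    rw [coeff_succ_X_mul, map_add, map_add, coeff_C_mul, coeff_C_mul, hyS, hrec, pow_two,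
      coeff_mul, Finset.Nat.sum_antidiagonal_eq_sum_range_succ_mk]
    obtain _ | a := a
    · simp [hy0, h1]
      field_simp
    · rw [Finset.sum_range_succ', Finset.sum_range_succ, Finset.sum_range_succ',
        Finset.sum_range_succ]
      simp only [hy0, hyS, Nat.sub_self, zero_mul, mul_zero, add_zero]
      have hsum : ∑ j ∈ Finset.range a, (if j + 1 = 0 then m else m - 1) * e (j + 1 + 1) *
            (m * e (a + 1 + 1 - (j + 1))) = (m - 1) * m * m ^ (a + 3) *
          ∑ k ∈ Finset.range a, e (k + 2) / m ^ (k + 2) * coeff (a + 1 - (k + 1)) y := by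
        rw [Finset.mul_sum]
        refine Finset.sum_congr rfl fun j hj => ?_
        rw [Finset.mem_range] at hj
        obtain ⟨i, rfl⟩ : ∃ i, a = j + i + 1 := ⟨a - j - 1, by omega⟩
        rw [show j + i + 1 + 1 - (j + 1) = i + 1 by omega, hyS, if_neg (by omega),
          show j + i + 1 + 1 + 1 - (j + 1) = i + 2 by omega,
          show m ^ (j + i + 1 + 3) = m ^ (j + 2) * m ^ (i + 2) by rw [← pow_add]; congr 1; omega]
        field_simp
      rw [hsum]
      simp [h1, coeff_one]
      field_simp
      ring
  have h := coeff_eq_sum_nar (m - 1) m y hy n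
  rw [hyS, div_eq_iff (pow_ne_zero _ hm)] at h
  rw [h, mul_comm]

/-- For `n ≥ 2`, the number of noncrossing `M`-cliques of arity `n` equals
`Σ_{k=0}^{n−2} m^{n+k+1} (m−1)^{n−k−2} nar(n,k)` where `m = #M`. -/
theorem statement1 (M : Type) [MulOneClass M] [Fintype M] (n : ℕ) (hn : 2 ≤ n) :
    ncCount M n
      = ∑ k ∈ Finset.range (n - 1),
          Fintype.card M ^ (n + k + 1) * (Fintype.card M - 1) ^ (n - k - 2) * nar n k := by
  obtain ⟨n, rfl⟩ := Nat.exists_eq_add_of_le' hn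
  have hm : 1 ≤ Fintype.card M := Fintype.card_pos_iff.2 ⟨1⟩
  have h := eq_sum_nar_of_rec (Fintype.card M) (by positivity)
    (fun l => Nat.card {p // IsNC 0 l ({1} : Set M) p}) (by simp [IsNC.card_one M])
    (fun l => by
      rw [IsNC.card_rec M l]
      push_cast [Nat.cast_sub hm]
      rfl) n
  rw [ncCount_eq M hn, IsNC.card_eq (by omega), Nat.card_univ, Nat.card_eq_fintype_card (α := M),
    Nat.sub_zero, ← Nat.cast_inj (R := ℚ), Nat.cast_mul, h]
  push_cast [Nat.cast_sub hm]
  rw [Finset.mul_sum, Finset.mul_sum]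
  refine Finset.sum_congr rfl fun k _ => ?_
  rw [show n + 2 - k - 2 = n - k by omega]
  ring
end

section
/- Let M be a unitary magma and let p be a noncrossing M-clique of arity n ≥ 2. Then there exist a unique integer k ≥ 2, a unique M-bubble q of arity k, and unique noncrossing M-cliques r_1, …, r_k each having base labeled 1_M, such that p = q ∘ [r_1,…,r_k] and k is maximal, i.e., k ≥ k' for every other decomposition p = q' ∘ [r'_1,…,r'_{k'}] with q' an M-bubble of arity k' ≥ 2 and all r'_i noncrossing M-cliques with base labeled 1_M. -/
/-! Bundled `M`-cliques for a unitary magma `M` (modeled as `MulOneClass`), with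
1-indexed vertices `1, …, arity+1`, and their partial composition. -/

/-- A (bundled) `M`-clique: an arity `n ≥ 1` together with a labeling of the arcs
`(x,y)`, `1 ≤ x < y ≤ n+1`, by elements of `M`; the labeling is normalized to take
the value `1` outside of this domain, so that equality of cliques is equality of
arities and labelings. -/
structure Cl (M : Type) [One M] where
  arity : ℕ
  lab : ℕ → ℕ → M
  norm : ∀ x y : ℕ, ¬(1 ≤ x ∧ x < y ∧ y ≤ arity + 1) → lab x y = 1

namespace Cl

/-- The unit clique: the unique noncrossing `M`-clique of arity 1. -/
def unitCl (M : Type) [One M] : Cl M :=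
  ⟨1, fun _ _ => 1, fun _ _ _ => rfl⟩

variable {M : Type} [One M]

/-- `(x,y)` is a diagonal of `c`: an arc which is neither an edge `(i,i+1)` nor
the base `(1, arity+1)`. -/
def IsDiag (c : Cl M) (x y : ℕ) : Prop :=
  1 ≤ x ∧ x < y ∧ y ≤ c.arity + 1 ∧ y ≠ x + 1 ∧ ¬(x = 1 ∧ y = c.arity + 1)

/-- A clique is noncrossing when no two of its solid diagonals cross. -/
def Noncrossing (c : Cl M) : Prop :=
  ∀ x y x' y' : ℕ, c.IsDiag x y → c.IsDiag x' y' →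
    c.lab x y ≠ 1 → c.lab x' y' ≠ 1 →
    ¬((x < x' ∧ x' < y ∧ y < y') ∨ (x' < x ∧ x < y' ∧ y' < y))

/-- A bubble is a clique all of whose diagonals are labeled by the unit. -/
def IsBubble (c : Cl M) : Prop := ∀ x y : ℕ, c.IsDiag x y → c.lab x y = 1

/-- Partial composition `p ∘ᵢ q` of cliques: glue the base of `q` onto the `i`-th
edge of `p`; the glued arc `(i, i + arity q)` is labeled `pᵢ ⋆ q₀`, the other arcs
of `p` and `q` keep their labels on their images, and all remaining arcs are
labeled by the unit. -/
def comp {M : Type} [MulOneClass M] (p : Cl M) (i : ℕ) (q : Cl M) : Cl M where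
  arity := p.arity + q.arity - 1
  lab := fun x y =>
    if 1 ≤ x ∧ x < y ∧ y ≤ (p.arity + q.arity - 1) + 1 then
      if x = i ∧ y = i + q.arity then
        p.lab i (i + 1) * q.lab 1 (q.arity + 1)
      else if i ≤ x ∧ y ≤ i + q.arity then
        q.lab (x - i + 1) (y - i + 1)
      else if (x ≤ i ∨ i + q.arity ≤ x) ∧ (y ≤ i ∨ i + q.arity ≤ y) then
        p.lab (if x ≤ i then x else x + 1 - q.arity)
          (if y ≤ i then y else y + 1 - q.arity)
      else 1
    else 1
  norm := fun _ _ h => if_neg h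

end Cl

namespace Cl

/-- Complete composition, auxiliary version taking the list of arguments in
reversed order: `ccompAux q [r_k, …, r_1] = (…((q ∘_k r_k) ∘_{k−1} r_{k−1})…) ∘_1 r_1`. -/
def ccompAux {M : Type} [MulOneClass M] (q : Cl M) : List (Cl M) → Cl M
  | [] => q
  | r :: rs => ccompAux (comp q (rs.length + 1) r) rs

/-- Complete composition `q ∘ [r_1, …, r_k] = (…((q ∘_k r_k) ∘_{k−1} r_{k−1})…) ∘_1 r_1`. -/
def ccomp {M : Type} [MulOneClass M] (q : Cl M) (rs : List (Cl M)) : Cl M :=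
  ccompAux q rs.reverse

end Cl

/-- `r` is a noncrossing `M`-clique whose base is labeled by the unit. -/
def IsUnitBased {M : Type} [One M] (r : Cl M) : Prop :=
  1 ≤ r.arity ∧ r.Noncrossing ∧ r.lab 1 (r.arity + 1) = 1

/-- `p = q ∘ [r_1, …, r_k]` where `q` is an `M`-bubble of arity `k ≥ 2` and the `r_i`
are noncrossing `M`-cliques whose bases are labeled by the unit. -/
def GoodDecomp {M : Type} [MulOneClass M] (p q : Cl M) (rs : List (Cl M)) : Prop :=
  2 ≤ q.arity ∧ q.IsBubble ∧ rs.length = q.arity ∧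
    (∀ r ∈ rs, IsUnitBased r) ∧ p = Cl.ccomp q rs

namespace Cl

theorem ext_of_lab {M : Type} [One M] {c d : Cl M} (ha : c.arity = d.arity)
    (hl : ∀ x y, 1 ≤ x → x < y → y ≤ c.arity + 1 → c.lab x y = d.lab x y) : c = d := by
  have h : c.lab = d.lab := by
    funext x y
    by_cases hxy : 1 ≤ x ∧ x < y ∧ y ≤ c.arity + 1
    · exact hl x y hxy.1 hxy.2.1 hxy.2.2
    · rw [c.norm x y hxy, d.norm x y (by rwa [← ha])]
  cases c
  cases d
  cases ha
  cases h
  rfl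

theorem ccomp_map_range_succ {M : Type} [MulOneClass M] (q : Cl M) (r : ℕ → Cl M) (m : ℕ) :
    ccomp q ((List.range (m + 1)).map r) =
      ccomp (comp q (m + 1) (r m)) ((List.range m).map r) := by
  simp [ccomp, ccompAux, List.range_succ]

end Cl

theorem lt_of_lt_succ_upto {s : ℕ → ℕ} {k : ℕ} (hs : ∀ i < k, s i < s (i + 1)) {a b : ℕ}
    (hab : a < b) (hb : b ≤ k) : s a < s b := by
  induction b, hab using Nat.le_induction with
  | base => exact hs a hb
  | succ b _ ih => exact (ih (by omega)).trans (hs b hb)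

theorem le_of_lt_succ_upto {s : ℕ → ℕ} {k : ℕ} (hs : ∀ i < k, s i < s (i + 1)) {a b : ℕ}
    (hab : a ≤ b) (hb : b ≤ k) : s a ≤ s b := by
  rcases hab.eq_or_lt with rfl | h
  · rfl
  · exact (lt_of_lt_succ_upto hs h hb).le

theorem lt_of_apply_lt_upto {s : ℕ → ℕ} {k : ℕ} (hs : ∀ i < k, s i < s (i + 1)) {a b : ℕ}
    (ha : a ≤ k) (h : s a < s b) : a < b := by
  by_contra hab
  exact absurd (le_of_lt_succ_upto hs (not_lt.mp hab) ha) (by omega)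

theorem exists_mem_block {s : ℕ → ℕ} {k x : ℕ} (h0 : s 0 ≤ x) (hk : x < s k) :
    ∃ j < k, s j ≤ x ∧ x < s (j + 1) := by
  induction k with
  | zero => omega
  | succ k ih =>
    by_cases h : x < s k
    · obtain ⟨j, hj, h1⟩ := ih h
      exact ⟨j, by omega, h1⟩
    · exact ⟨k, by omega, by omega, hk⟩

/-- `IsSubst p q r s m` says that `p` is obtained from `q` by gluing `r 0, …, r (m - 1)` onto the
first `m` edges of `q`, the vertex `j + 1` of `q` becoming the vertex `s j` of `p`. -/
structure IsSubst {M : Type} [One M] (p q : Cl M) (r : ℕ → Cl M) (s : ℕ → ℕ) (m : ℕ) : Prop where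
  last : s q.arity = p.arity + 1
  outer : ∀ a b, a < b → b ≤ q.arity → p.lab (s a) (s b) = q.lab (a + 1) (b + 1)
  inner : ∀ j < m, ∀ x y, s j ≤ x → x < y → y ≤ s (j + 1) → ¬(x = s j ∧ y = s (j + 1)) →
    p.lab x y = (r j).lab (x - s j + 1) (y - s j + 1)
  rest : ∀ x y, (¬∃ a b, a < b ∧ b ≤ q.arity ∧ x = s a ∧ y = s b) →
    (¬∃ j < m, s j ≤ x ∧ x < y ∧ y ≤ s (j + 1)) → p.lab x y = 1

theorem IsSubst.unique {M : Type} [One M] {p p' q : Cl M} {r : ℕ → Cl M} {s : ℕ → ℕ} {m : ℕ}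
    (hm : m ≤ q.arity)
    (h : IsSubst p q r s m) (h' : IsSubst p' q r s m) : p = p' := by
  refine Cl.ext_of_lab (by have := h.last; have := h'.last; omega) fun x y _ hxy _ => ?_
  by_cases h1 : ∃ a b, a < b ∧ b ≤ q.arity ∧ x = s a ∧ y = s b
  · obtain ⟨a, b, hab, hb, rfl, rfl⟩ := h1
    rw [h.outer a b hab hb, h'.outer a b hab hb]
  by_cases h2 : ∃ j < m, s j ≤ x ∧ x < y ∧ y ≤ s (j + 1)
  · obtain ⟨j, hj, hx, _, hy⟩ := h2
    have hne : ¬(x = s j ∧ y = s (j + 1)) := fun e =>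
      h1 ⟨j, j + 1, by omega, by omega, e.1, e.2⟩
    rw [h.inner j hj x y hx hxy hy hne, h'.inner j hj x y hx hxy hy hne]
  · rw [h.rest x y h1 h2, h'.rest x y h1 h2]

theorem Cl.isSubst_ccomp {M : Type} [MulOneClass M] (r : ℕ → Cl M) (m : ℕ) :
    ∀ (q : Cl M) (s : ℕ → ℕ), m ≤ q.arity → s 0 = 1 →
      (∀ i < m, s (i + 1) = s i + (r i).arity) → (∀ i, m ≤ i → s (i + 1) = s i + 1) →
      (∀ i < m, IsUnitBased (r i)) →
      IsSubst (ccomp q ((List.range m).map r)) q r s m := by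
  induction m with
  | zero =>
    intro q s _ h0 _ hs _
    have hs' : ∀ j, s j = j + 1 := by
      intro j
      induction j with
      | zero => exact h0
      | succ j ih => rw [hs j (by omega), ih]
    have hc : ccomp q ((List.range 0).map r) = q := rfl
    rw [hc]
    refine ⟨hs' _, fun a b _ _ => by rw [hs', hs'], fun j hj => by omega, fun x y h _ => ?_⟩
    refine q.norm x y fun hxy => h ⟨x - 1, y - 1, by omega, by omega, ?_, ?_⟩ <;> rw [hs'] <;> omega
  | succ m ih =>
    intro q s hm h0 hs1 hs2 hr
    obtain ⟨hr1, -, hr2⟩ := hr m (by omega)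
    have hsm := hs1 m (by omega)
    set l := (r m).arity with hl
    set q' := comp q (m + 1) (r m) with hq'
    have hqa : q'.arity = q.arity + l - 1 := rfl
    have hlab : ∀ x y, q'.lab x y =
        if 1 ≤ x ∧ x < y ∧ y ≤ (q.arity + l - 1) + 1 then
          if x = m + 1 ∧ y = m + 1 + l then q.lab (m + 1) (m + 1 + 1) * (r m).lab 1 (l + 1)
          else if m + 1 ≤ x ∧ y ≤ m + 1 + l then (r m).lab (x - (m + 1) + 1) (y - (m + 1) + 1)
          else if (x ≤ m + 1 ∨ m + 1 + l ≤ x) ∧ (y ≤ m + 1 ∨ m + 1 + l ≤ y) then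
            q.lab (if x ≤ m + 1 then x else x + 1 - l) (if y ≤ m + 1 then y else y + 1 - l)
          else 1
        else 1 := fun _ _ => rfl
    set s' : ℕ → ℕ := fun j => if j ≤ m then s j else s m + (j - m) with hs'
    have hlow : ∀ j, j ≤ m → s' j = s j := fun j hj => if_pos hj
    have hmid : ∀ j, m ≤ j → s' j = s m + (j - m) := by
      intro j hj
      rcases hj.eq_or_lt with rfl | h
      · simp [hs']
      · exact if_neg (by omega)
    have hhigh : ∀ t, s (m + 1 + t) = s m + l + t := by
      intro t
      induction t with
      | zero => simpa using hsm
      | succ t iht => have := hs2 (m + 1 + t) (by omega); rw [← add_assoc, this, iht, add_assoc]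
    have hhigh' : ∀ j, m + 1 ≤ j → s j = s' (j + l - 1) := by
      intro j hj
      obtain ⟨t, rfl⟩ := Nat.exists_eq_add_of_le hj
      rw [hhigh, hmid _ (by omega)]
      omega
    have H : IsSubst (ccomp q' ((List.range m).map r)) q' r s' m := by
      refine ih q' s' (by omega) ?_ ?_ ?_ fun i hi => hr i (by omega)
      · rw [hlow 0 (by omega), h0]
      · intro i hi
        rw [hlow _ hi, hlow i (by omega)]
        exact hs1 i (by omega)
      · intro i hi
        rw [hmid _ hi, hmid (i + 1) (by omega)]
        omega
    rw [ccomp_map_range_succ, ← hq']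
    refine ⟨?_, ?_, ?_, ?_⟩
    · rw [← H.last, hqa, hhigh' _ hm]
    · intro a b hab hb
      by_cases hbm : b ≤ m
      · rw [← hlow a (by omega), ← hlow b hbm, H.outer a b hab (by omega), hlab,
          if_pos (by omega), if_neg (by omega), if_neg (by omega), if_pos (by omega),
          if_pos (by omega), if_pos (by omega)]
      rw [hhigh' b (by omega)]
      by_cases ham : a ≤ m
      · rw [← hlow a ham, H.outer a _ (by omega) (by omega), hlab, if_pos (by omega)]
        by_cases he : a = m ∧ b = m + 1
        · rw [if_pos (by omega), hr2, mul_one, he.1, he.2]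
        · rw [if_neg (by omega), if_neg (by omega), if_pos (by omega), if_pos (by omega),
            if_neg (by omega)]
          congr 1
          omega
      · rw [hhigh' a (by omega), H.outer _ _ (by omega) (by omega), hlab, if_pos (by omega),
          if_neg (by omega), if_neg (by omega), if_pos (by omega), if_neg (by omega),
          if_neg (by omega)]
        congr 1 <;> omega
    · intro j hj x y hx hxy hy hne
      by_cases hjm : j < m
      · rw [← hlow j hjm.le] at hx hne ⊢
        rw [← hlow _ hjm] at hy hne
        exact H.inner j hjm x y hx hxy hy hne
      · obtain rfl : j = m := by omega
        obtain ⟨u, rfl⟩ := Nat.exists_eq_add_of_le hx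
        obtain ⟨v, rfl⟩ := Nat.exists_eq_add_of_le (hx.trans hxy.le)
        have e : ∀ w, s j + w = s' (j + w) := fun w => by rw [hmid _ (by omega)]; omega
        have := H.outer (j + u) (j + v) (by omega) (by omega)
        rw [← e, ← e, hlab, if_pos (by omega), if_neg (by omega), if_pos (by omega)] at this
        rw [this]
        congr 1 <;> omega
    · intro x y h1 h2
      by_cases h : ∃ a b, a < b ∧ b ≤ q'.arity ∧ x = s' a ∧ y = s' b
      · obtain ⟨a, b, hab, hb, rfl, rfl⟩ := h
        rw [H.outer a b hab hb, hlab, if_pos (by omega)]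
        have hblock : ¬(m ≤ a ∧ b ≤ m + l) := fun hh =>
          h2 ⟨m, by omega, by rw [hmid a hh.1]; omega, by
            rw [hmid a hh.1, hmid b (by omega)]; omega, by rw [hmid b (by omega)]; omega⟩
        have himg : ∀ c, c ≤ q'.arity → (c ≤ m ∨ m + l ≤ c) →
            ∃ d ≤ q.arity, s' c = s d ∧ c = (if d ≤ m then d else d + l - 1) := by
          rintro c hc (h | h)
          · exact ⟨c, by omega, hlow c h, by simp [h]⟩
          · refine ⟨c + 1 - l, by omega, ?_, ?_⟩
            · rw [hhigh' _ (by omega)]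
              congr 1
              omega
            · rw [if_neg (by omega)]
              omega
        rw [if_neg (by omega), if_neg (by omega), if_neg]
        rintro ⟨ha', hb'⟩
        obtain ⟨a', ha1, ha2, ha3⟩ := himg a (by omega) (by omega)
        obtain ⟨b', hb1, hb2, hb3⟩ := himg b hb (by omega)
        refine h1 ⟨a', b', ?_, hb1, ha2, hb2⟩
        split_ifs at ha3 hb3 <;> omega
      · refine H.rest x y h fun ⟨j, hj, hx, hxy, hy⟩ => h2 ⟨j, by omega, ?_, hxy, ?_⟩
        · rwa [← hlow j hj.le]
        · rwa [← hlow _ hj]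

/-- A decomposition of `p` into a bubble `q` of arity `k` and unit-based cliques `r 0, …, r (k - 1)`,
where the vertex `j + 1` of `q` is the vertex `s j` of `p`. -/
structure IsCutting {M : Type} [One M] (p q : Cl M) (r : ℕ → Cl M) (s : ℕ → ℕ) : Prop where
  two_le : 2 ≤ q.arity
  bubble : q.IsBubble
  unitBased : ∀ i < q.arity, IsUnitBased (r i)
  zero : s 0 = 1
  step : ∀ i < q.arity, s (i + 1) = s i + (r i).arity
  subst : IsSubst p q r s q.arity

theorem IsCutting.lt_succ {M : Type} [One M] {p q : Cl M} {r : ℕ → Cl M} {s : ℕ → ℕ}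
    (h : IsCutting p q r s) : ∀ i < q.arity, s i < s (i + 1) := fun i hi => by
  have := (h.unitBased i hi).1
  have := h.step i hi
  omega

theorem GoodDecomp.exists_isCutting {M : Type} [MulOneClass M] {p q : Cl M} {rs : List (Cl M)}
    (h : GoodDecomp p q rs) :
    ∃ r s, rs = (List.range q.arity).map r ∧ IsCutting p q r s := by
  obtain ⟨h2, hb, hlen, hr, hp⟩ := h
  set r : ℕ → Cl M := fun i => rs.getD i (Cl.unitCl M) with hr_def
  have hrs : rs = (List.range q.arity).map r := by
    refine List.ext_getElem (by simp [hlen]) fun i h _ => ?_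
    simp [hr_def, h]
  have hu : ∀ i < q.arity, IsUnitBased (r i) := fun i hi =>
    hr _ (by rw [hrs]; exact List.mem_map_of_mem (List.mem_range.mpr hi))
  set s : ℕ → ℕ := fun j => 1 + ∑ i ∈ Finset.range j, if i < q.arity then (r i).arity else 1
  have hs1 : ∀ i < q.arity, s (i + 1) = s i + (r i).arity := fun i hi => by
    simp [s, Finset.sum_range_succ, hi, add_assoc]
  have hs2 : ∀ i, q.arity ≤ i → s (i + 1) = s i + 1 := fun i hi => by
    simp [s, Finset.sum_range_succ, hi.not_gt, add_assoc]
  refine ⟨r, s, hrs, h2, hb, hu, by simp [s], hs1, ?_⟩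
  rw [hp, hrs]
  exact Cl.isSubst_ccomp r _ q s le_rfl (by simp [s]) hs1 hs2 hu

theorem IsCutting.goodDecomp {M : Type} [MulOneClass M] {p q : Cl M} {r : ℕ → Cl M} {s : ℕ → ℕ}
    (h : IsCutting p q r s) : GoodDecomp p q ((List.range q.arity).map r) := by
  refine ⟨h.two_le, h.bubble, by simp, ?_, ?_⟩
  · intro c hc
    obtain ⟨i, hi, rfl⟩ := List.mem_map.mp hc
    exact h.unitBased i (List.mem_range.mp hi)
  · set t : ℕ → ℕ := fun j => if j ≤ q.arity then s j else s q.arity + (j - q.arity)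
    have hlow : ∀ j, j ≤ q.arity → t j = s j := fun j hj => if_pos hj
    have ht : IsSubst p q r t q.arity := by
      obtain ⟨h1, h2, h3, h4⟩ := h.subst
      refine ⟨by rw [hlow _ le_rfl, h1], fun a b hab hb => ?_, fun j hj => ?_,
        fun x y hx hy => h4 x y ?_ ?_⟩
      · rw [hlow a (by omega), hlow b hb, h2 a b hab hb]
      · rw [hlow j hj.le, hlow _ hj]
        exact h3 j hj
      · rintro ⟨a, b, hab, hb, rfl, rfl⟩
        exact hx ⟨a, b, hab, hb, (hlow a (by omega)).symm, (hlow b hb).symm⟩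
      · rintro ⟨j, hj, hh⟩
        exact hy ⟨j, hj, by rwa [hlow j hj.le, hlow _ hj]⟩
    refine ht.unique le_rfl (Cl.isSubst_ccomp r _ q t le_rfl ?_ ?_ ?_ h.unitBased)
    · rw [hlow 0 (by omega), h.zero]
    · intro i hi
      rw [hlow _ hi, hlow i hi.le, h.step i hi]
    · intro i hi
      have hhigh : ∀ j, q.arity ≤ j → t j = s q.arity + (j - q.arity) := by
        intro j hj
        rcases hj.eq_or_lt with rfl | h
        · simp [t]
        · exact if_neg (by omega)
      rw [hhigh i hi, hhigh (i + 1) (by omega)]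
      omega

theorem IsCutting.ext {M : Type} [One M] {p q q' : Cl M} {r r' : ℕ → Cl M} {s s' : ℕ → ℕ}
    (h : IsCutting p q r s) (h' : IsCutting p q' r' s') (ha : q'.arity = q.arity)
    (hs : ∀ j ≤ q.arity, s' j = s j) : q' = q ∧ ∀ i < q.arity, r' i = r i := by
  constructor
  · refine Cl.ext_of_lab ha fun x y hx hxy hy => ?_
    have e := h.subst.outer (x - 1) (y - 1) (by omega) (by omega)
    have e' := h'.subst.outer (x - 1) (y - 1) (by omega) (by omega)
    rw [hs _ (by omega), hs _ (by omega), e] at e'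
    rw [show x - 1 + 1 = x by omega, show y - 1 + 1 = y by omega] at e'
    exact e'.symm
  · intro i hi
    have hsi := hs i hi.le
    have hsi' := hs (i + 1) hi
    have e1 := h.step i hi
    have e2 := h'.step i (by omega)
    have har : (r' i).arity = (r i).arity := by omega
    refine Cl.ext_of_lab har fun x y hx hxy hy => ?_
    by_cases hbase : x = 1 ∧ y = (r i).arity + 1
    · obtain ⟨rfl, rfl⟩ := hbase
      rw [(h.unitBased i hi).2.2, ← har, (h'.unitBased i (by omega)).2.2]
    · have e := h.subst.inner i hi (s i + x - 1) (s i + y - 1) (by omega) (by omega) (by omega)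
        (by omega)
      have e' := h'.subst.inner i (by omega) (s i + x - 1) (s i + y - 1) (by omega) (by omega)
        (by omega) (by omega)
      rw [hsi, e] at e'
      rw [show s i + x - 1 - s i + 1 = x by omega, show s i + y - 1 - s i + 1 = y by omega] at e'
      exact e'.symm

open Classical in
/-- The vertices of `p` that no solid diagonal of `p` strictly separates from the base. -/
noncomputable def Cl.exposed {M : Type} [One M] (p : Cl M) : Finset ℕ :=
  (Finset.Icc 1 (p.arity + 1)).filter fun v =>
    ∀ x y, p.IsDiag x y → p.lab x y ≠ 1 → ¬(x < v ∧ v < y)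

theorem Cl.mem_exposed {M : Type} [One M] {p : Cl M} {v : ℕ} :
    v ∈ p.exposed ↔ (1 ≤ v ∧ v ≤ p.arity + 1) ∧
      ∀ x y, p.IsDiag x y → p.lab x y ≠ 1 → ¬(x < v ∧ v < y) := by
  simp [exposed]

theorem Cl.Noncrossing.three_le_card_exposed {M : Type} [One M] {p : Cl M}
    (hnc : p.Noncrossing) (h2 : 2 ≤ p.arity) : 3 ≤ p.exposed.card := by
  have key : ∃ v ∈ p.exposed, 1 < v ∧ v < p.arity + 1 := by
    by_cases hd : ∃ d x, p.IsDiag x (x + d) ∧ p.lab x (x + d) ≠ 1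
    · classical
      have hbd : ∀ d, (∃ x, p.IsDiag x (x + d) ∧ p.lab x (x + d) ≠ 1) → d ≤ p.arity := by
        rintro d ⟨x, ⟨hx, _, hy, _⟩, _⟩
        omega
      obtain ⟨d₀, hd₀⟩ := hd
      obtain ⟨x, hx, hx'⟩ := Nat.findGreatest_spec
        (P := fun d => ∃ x, p.IsDiag x (x + d) ∧ p.lab x (x + d) ≠ 1) (hbd d₀ hd₀) hd₀
      set d := Nat.findGreatest
        (fun d => ∃ x, p.IsDiag x (x + d) ∧ p.lab x (x + d) ≠ 1) p.arity
      have hmax : ∀ a b, p.IsDiag a b → p.lab a b ≠ 1 → b - a ≤ d := by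
        intro a b hab hab'
        have hlt := hab.2.1
        have e : a + (b - a) = b := by omega
        have hP : ∃ x, p.IsDiag x (x + (b - a)) ∧ p.lab x (x + (b - a)) ≠ 1 :=
          ⟨a, by rwa [e], by rwa [e]⟩
        exact Nat.le_findGreatest (hbd _ hP) hP
      have hxd := hx
      obtain ⟨h1, h3, h4, h5, h6⟩ := hx
      by_cases hx1 : x = 1
      · refine ⟨x + d, Cl.mem_exposed.mpr ⟨by omega, fun a b hab hab' hv => ?_⟩, by omega, by omega⟩
        have := hnc _ _ _ _ hxd hab hx' hab'
        have := hmax a b hab hab'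
        omega
      · refine ⟨x, Cl.mem_exposed.mpr ⟨by omega, fun a b hab hab' hv => ?_⟩, by omega, by omega⟩
        have := hnc _ _ _ _ hxd hab hx' hab'
        have := hmax a b hab hab'
        omega
    · refine ⟨2, Cl.mem_exposed.mpr ⟨by omega, fun a b hab hab' _ => hd ⟨b - a, a, ?_⟩⟩, by omega,
        by omega⟩
      have hlt := hab.2.1
      rw [show a + (b - a) = b by omega]
      exact ⟨hab, hab'⟩
  obtain ⟨v, hv, hv1, hv2⟩ := key
  have hsub : ({1, v, p.arity + 1} : Finset ℕ) ⊆ p.exposed := by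
    intro w hw
    simp only [Finset.mem_insert, Finset.mem_singleton] at hw
    rcases hw with rfl | rfl | rfl
    · exact Cl.mem_exposed.mpr ⟨by omega, fun x y h _ => by have := h.1; omega⟩
    · exact hv
    · exact Cl.mem_exposed.mpr ⟨by omega, fun x y h _ => by have := h.2.2.1; omega⟩
  have hcard : ({1, v, p.arity + 1} : Finset ℕ).card = 3 := by
    rw [Finset.card_eq_three]
    exact ⟨1, v, p.arity + 1, by omega, by omega, by omega, rfl⟩
  exact hcard ▸ Finset.card_le_card hsub

theorem IsCutting.mem_exposed {M : Type} [One M] {p q : Cl M} {r : ℕ → Cl M} {s : ℕ → ℕ}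
    (h : IsCutting p q r s) {j : ℕ} (hj : j ≤ q.arity) : s j ∈ p.exposed := by
  have hlast := h.subst.last
  have hzero := h.zero
  refine Cl.mem_exposed.mpr ⟨⟨?_, ?_⟩, ?_⟩
  · rw [← hzero]
    exact le_of_lt_succ_upto h.lt_succ (Nat.zero_le j) hj
  · rw [← hlast]
    exact le_of_lt_succ_upto h.lt_succ hj le_rfl
  rintro x y hd hne ⟨hx, hy⟩
  refine hne (h.subst.rest x y ?_ ?_)
  · rintro ⟨a, b, hab, hb, rfl, rfl⟩
    have haj := lt_of_apply_lt_upto h.lt_succ (by omega) hx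
    have hjb := lt_of_apply_lt_upto h.lt_succ hj hy
    refine hne ((h.subst.outer a b hab hb).trans (h.bubble _ _ ⟨by omega, by omega, by omega,
      by omega, ?_⟩))
    rintro ⟨ha, hb'⟩
    obtain rfl : a = 0 := by omega
    obtain rfl : b = q.arity := by omega
    exact hd.2.2.2.2 ⟨hzero, hlast⟩
  · rintro ⟨i, hi, h1, _, h3⟩
    have := lt_of_apply_lt_upto h.lt_succ hi.le (h1.trans_lt hx)
    have := lt_of_apply_lt_upto h.lt_succ hj (hy.trans_le h3)
    omega

theorem IsCutting.strictMono {M : Type} [One M] {p q : Cl M} {r : ℕ → Cl M} {s : ℕ → ℕ}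
    (h : IsCutting p q r s) : StrictMono fun j : Fin (q.arity + 1) => s j :=
  fun _ b hab => lt_of_lt_succ_upto h.lt_succ hab (Nat.lt_succ_iff.mp b.2)

theorem IsCutting.arity_lt_card {M : Type} [One M] {p q : Cl M} {r : ℕ → Cl M} {s : ℕ → ℕ}
    (h : IsCutting p q r s) : q.arity + 1 ≤ p.exposed.card := by
  have := Finset.card_le_card_of_injOn (s := Finset.univ) (t := p.exposed)
    (fun j : Fin (q.arity + 1) => s j)
    (fun j _ => h.mem_exposed (Nat.lt_succ_iff.mp j.2)) h.strictMono.injective.injOn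
  simpa using this

theorem Cl.Noncrossing.exists_isCutting {M : Type} [One M] {p : Cl M}
    (hnc : p.Noncrossing) (h2 : 2 ≤ p.arity) :
    ∃ q r s, IsCutting p q r s ∧ p.exposed.card = q.arity + 1 := by
  have h3 := hnc.three_le_card_exposed h2
  obtain ⟨k, hk⟩ : ∃ k, p.exposed.card = k + 1 := ⟨p.exposed.card - 1, by omega⟩
  set f := p.exposed.orderEmbOfFin hk
  set s : ℕ → ℕ := fun j => if h : j < k + 1 then f ⟨j, h⟩ else 0 with hs_def
  have hsf : ∀ j (h : j < k + 1), s j = f ⟨j, h⟩ := fun j h => dif_pos h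
  have hs : ∀ i < k, s i < s (i + 1) := by
    intro i hi
    rw [hsf i (by omega), hsf (i + 1) (by omega)]
    exact f.strictMono (by simp [Fin.lt_def])
  have hmem : ∀ j ≤ k, s j ∈ p.exposed := by
    intro j hj
    rw [hsf j (by omega)]
    exact Finset.orderEmbOfFin_mem _ _ _
  have hsurj : ∀ v ∈ p.exposed, ∃ j ≤ k, s j = v := by
    intro v hv
    have : v ∈ Set.range f := by
      rw [Finset.range_orderEmbOfFin]
      exact hv
    obtain ⟨j, rfl⟩ := this
    exact ⟨j, Nat.lt_succ_iff.mp j.2, hsf _ j.2⟩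
  have h0 : s 0 = 1 := by
    obtain ⟨j, hj, e⟩ := hsurj 1
      (Cl.mem_exposed.mpr ⟨by omega, fun x y h _ => by have := h.1; omega⟩)
    have := le_of_lt_succ_upto hs (Nat.zero_le j) hj
    have := (Cl.mem_exposed.mp (hmem 0 (by omega))).1
    omega
  have hlast : s k = p.arity + 1 := by
    obtain ⟨j, hj, e⟩ := hsurj (p.arity + 1)
      (Cl.mem_exposed.mpr ⟨by omega, fun x y h _ => by have := h.2.2.1; omega⟩)
    have := le_of_lt_succ_upto hs hj le_rfl
    have := (Cl.mem_exposed.mp (hmem k le_rfl)).1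
    omega
  have hcov : ∀ x y j, j ≤ k → p.IsDiag x y → x < s j → s j < y → p.lab x y = 1 := by
    intro x y j hj hd hx hy
    by_contra hne
    exact (Cl.mem_exposed.mp (hmem j hj)).2 x y hd hne ⟨hx, hy⟩
  let q : Cl M :=
    { arity := k
      lab := fun x y => if 1 ≤ x ∧ x < y ∧ y ≤ k + 1 then p.lab (s (x - 1)) (s (y - 1)) else 1
      norm := fun _ _ h => if_neg h }
  let r : ℕ → Cl M := fun j =>
    { arity := s (j + 1) - s j
      lab := fun x y =>
        if (1 ≤ x ∧ x < y ∧ y ≤ s (j + 1) - s j + 1) ∧ ¬(x = 1 ∧ y = s (j + 1) - s j + 1) then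
          p.lab (s j + x - 1) (s j + y - 1) else 1
      norm := fun _ _ h => if_neg fun h' => h h'.1 }
  have hbound : ∀ j ≤ k, 1 ≤ s j ∧ s j ≤ p.arity + 1 := fun j hj =>
    (Cl.mem_exposed.mp (hmem j hj)).1
  refine ⟨q, r, s, ⟨by change 2 ≤ k; omega, ?_, ?_, h0, ?_, hlast, ?_, ?_, ?_⟩, hk⟩
  · rintro x y ⟨hx, hxy, hy, hne, hbase⟩
    change y ≤ k + 1 at hy
    change ¬(x = 1 ∧ y = k + 1) at hbase
    change (if _ then _ else _) = _
    rw [if_pos ⟨hx, hxy, hy⟩]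
    have h1 := lt_of_lt_succ_upto hs (show x - 1 < x by omega) (by omega)
    have h2 := lt_of_lt_succ_upto hs (show x < y - 1 by omega) (by omega)
    have hb1 := hbound (x - 1) (by omega)
    have hb2 := hbound (y - 1) (by omega)
    refine hcov _ _ x (by omega) ⟨hb1.1, by omega, hb2.2, by omega, ?_⟩ h1 h2
    rintro ⟨e1, e2⟩
    by_cases hx1 : x = 1
    · have := lt_of_lt_succ_upto hs (show y - 1 < k by omega) le_rfl
      omega
    · have := lt_of_lt_succ_upto hs (show 0 < x - 1 by omega) (by omega)
      omega
  · intro j hj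
    change j < k at hj
    have hlt := hs j hj
    have hb1 := hbound j (by omega)
    have hb2 := hbound (j + 1) hj
    have hproper : ¬(s j = 1 ∧ s (j + 1) = p.arity + 1) := by
      rintro ⟨e1, e2⟩
      by_cases hj0 : j = 0
      · have := lt_of_lt_succ_upto hs (show j + 1 < k by omega) le_rfl
        omega
      · have := lt_of_lt_succ_upto hs (show 0 < j by omega) hj.le
        omega
    have hdiag : ∀ x y, (r j).IsDiag x y → p.IsDiag (s j + x - 1) (s j + y - 1) ∧
        (r j).lab x y = p.lab (s j + x - 1) (s j + y - 1) := by
      rintro x y ⟨hx, hxy, hy, hne, hbase⟩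
      change y ≤ s (j + 1) - s j + 1 at hy
      change ¬(x = 1 ∧ y = s (j + 1) - s j + 1) at hbase
      exact ⟨⟨by omega, by omega, by omega, by omega, by omega⟩, if_pos ⟨⟨hx, hxy, hy⟩, hbase⟩⟩
    refine ⟨by change 1 ≤ s (j + 1) - s j; omega, ?_, if_neg fun h => h.2 ⟨rfl, rfl⟩⟩
    intro x y x' y' hd hd' hne hne' hcross
    obtain ⟨e1, e2⟩ := hdiag x y hd
    obtain ⟨e1', e2'⟩ := hdiag x' y' hd'
    rw [e2] at hne
    rw [e2'] at hne'
    have := hd.1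
    have := hd'.1
    exact hnc _ _ _ _ e1 e1' hne hne' (by omega)
  · intro i hi
    have := hs i hi
    change s (i + 1) = s i + (s (i + 1) - s i)
    omega
  · intro a b hab hb
    change b ≤ k at hb
    change _ = if _ then _ else _
    rw [if_pos (by omega)]
    rfl
  · intro j hj x y hx hxy hy hne
    have := hs j hj
    change _ = if _ then _ else _
    rw [if_pos (by omega)]
    congr 1 <;> omega
  · intro x y houter hinner
    change ¬∃ a b, a < b ∧ b ≤ k ∧ x = s a ∧ y = s b at houter
    change ¬∃ j < k, s j ≤ x ∧ x < y ∧ y ≤ s (j + 1) at hinner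
    by_cases hr : 1 ≤ x ∧ x < y ∧ y ≤ p.arity + 1
    · obtain ⟨hx, hxy, hy⟩ := hr
      obtain ⟨j, hj, hj1, hj2⟩ := exists_mem_block (s := s) (k := k) (x := x) (by omega) (by omega)
      have hjy : s (j + 1) < y := by
        by_contra hcon
        exact hinner ⟨j, hj, hj1, hxy, by omega⟩
      refine hcov x y (j + 1) hj ⟨hx, hxy, hy, by omega, ?_⟩ hj2 hjy
      rintro ⟨rfl, rfl⟩
      exact houter ⟨0, k, by omega, le_rfl, h0.symm, hlast.symm⟩
    · exact p.norm x y hr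

/-- Every noncrossing `M`-clique `p` of arity `≥ 2` admits a decomposition
`p = q ∘ [r_1, …, r_k]` as above with `k` maximal, and this maximal decomposition
is unique. -/
theorem statement3 {M : Type} [MulOneClass M] (p : Cl M)
    (hnc : p.Noncrossing) (h2 : 2 ≤ p.arity) :
    ∃ (q : Cl M) (rs : List (Cl M)),
      GoodDecomp p q rs ∧
      (∀ (q' : Cl M) (rs' : List (Cl M)), GoodDecomp p q' rs' → q'.arity ≤ q.arity) ∧
      (∀ (q' : Cl M) (rs' : List (Cl M)),
        GoodDecomp p q' rs' →
        (∀ (q'' : Cl M) (rs'' : List (Cl M)), GoodDecomp p q'' rs'' → q''.arity ≤ q'.arity) →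
        q' = q ∧ rs' = rs) := by
  obtain ⟨q, r, s, hc, hcard⟩ := hnc.exists_isCutting h2
  refine ⟨q, _, hc.goodDecomp, fun q' rs' h' => ?_, fun q' rs' h' hmax => ?_⟩
  · obtain ⟨r', s', -, hc'⟩ := h'.exists_isCutting
    have := hc'.arity_lt_card
    omega
  · obtain ⟨r', s', rfl, hc'⟩ := h'.exists_isCutting
    have hle := hc'.arity_lt_card
    have hge := hmax q _ hc.goodDecomp
    have ha : q'.arity = q.arity := by omega
    have e := Finset.orderEmbOfFin_unique hcard
      (fun j => hc.mem_exposed (Nat.lt_succ_iff.mp j.2)) hc.strictMono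
    have e' := Finset.orderEmbOfFin_unique hcard (f := fun j : Fin (q.arity + 1) => s' j)
      (fun j => hc'.mem_exposed (by omega))
      (fun a b hab => lt_of_lt_succ_upto hc'.lt_succ hab (by omega))
    have hs : ∀ j ≤ q.arity, s' j = s j := fun j hj =>
      congrFun (e'.trans e.symm) ⟨j, Nat.lt_succ_of_le hj⟩
    obtain ⟨hq, hr⟩ := hc.ext hc' ha hs
    refine ⟨hq, ?_⟩
    rw [ha]
    exact List.map_congr_left fun i hi => hr i (List.mem_range.mp hi)
end

section
/- Let K be a field of characteristic zero, M a finite unitary magma with m := #M, and V the K-vector space with basis {e(p,q,i) : p ∈ M³, q ∈ M³, i ∈ {1,2}}. Let R ⊆ V be the subspace spanned by all differences e(p,q,i) − e(p',q',i') such that ev(p,q,i) = ev(p',q',i'). Then dim R = 2m⁶ − 2m⁵ + m⁴. -/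
/-! `M`-triangles (elements of `M³`), their partial compositions `ev p q i`
(which are `M`-cliques of arity 3, i.e. labelings of the six arcs of a square),
and the space `V` with basis indexed by `M³ × M³ × {1, 2}` (the degree-2 syntax
trees on `M`-triangles); the index `i ∈ {1,2}` is encoded by a `Bool`, with
`true` standing for `i = 1` and `false` for `i = 2`. -/

/-- An `M`-clique of arity 3: the labels of the six arcs of a square with
vertices `1,2,3,4`: the base `(1,4)`, the edges `(1,2)`, `(2,3)`, `(3,4)` and the
diagonals `(1,3)`, `(2,4)`. -/
structure Sq (M : Type) where
  base : M
  e12 : M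
  e23 : M
  e34 : M
  d13 : M
  d24 : M

/-- The evaluation of the degree-2 syntax tree `(p, q, i)`:
the partial composition `p ∘ᵢ q` of the `M`-triangles `p = (p₀,p₁,p₂)` and
`q = (q₀,q₁,q₂)`.  For `i = 1` (encoded `true`): base `p₀`, edges `q₁,q₂,p₂`,
diagonal `(1,3)` labeled `p₁ ⋆ q₀` and diagonal `(2,4)` labeled `1`.
For `i = 2` (encoded `false`): base `p₀`, edges `p₁,q₁,q₂`, diagonal `(2,4)`
labeled `p₂ ⋆ q₀` and diagonal `(1,3)` labeled `1`. -/
def ev {M : Type} [MulOneClass M] (p q : M × M × M) (i : Bool) : Sq M :=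
  if i then ⟨p.1, q.2.1, q.2.2, p.2.2, p.2.1 * q.1, 1⟩
  else ⟨p.1, p.2.1, q.2.1, q.2.2, 1, p.2.2 * q.1⟩

/-- The basis vector `e(p,q,i)` of the space `V = K⟨M³ × M³ × {1,2}⟩`. -/
noncomputable def e (K : Type) [Field K] {M : Type} (p q : M × M × M) (i : Bool) :
    ((M × M × M) × (M × M × M) × Bool) →₀ K :=
  Finsupp.single (p, q, i) 1

/-- The set of all differences `e(p,q,i) − e(p',q',i')` with
`ev(p,q,i) = ev(p',q',i')`. -/
def evRelSet (K : Type) [Field K] (M : Type) [MulOneClass M] :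
    Set (((M × M × M) × (M × M × M) × Bool) →₀ K) :=
  {v | ∃ (p q : M × M × M) (i : Bool) (p' q' : M × M × M) (i' : Bool),
    ev p q i = ev p' q' i' ∧ v = e K p q i - e K p' q' i'}

/-- The span of the differences of basis vectors identified by `f` is the kernel of the linear
extension of `f`. -/
theorem span_single_sub_single_eq_ker {K α β : Type*} [Field K] {f : α → β}
    (hf : Function.Surjective f) :
    Submodule.span K {v : α →₀ K | ∃ a b, f a = f b ∧
      v = Finsupp.single a 1 - Finsupp.single b 1} = LinearMap.ker (Finsupp.lmapDomain K K f) := by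
  apply le_antisymm
  · rw [Submodule.span_le]
    rintro _ ⟨a, b, hab, rfl⟩
    rw [SetLike.mem_coe, LinearMap.mem_ker, map_sub]
    simp [hab]
  · intro v hv
    have key : ∀ w : α →₀ K, w - Finsupp.mapDomain (Function.surjInv hf ∘ f) w ∈
        Submodule.span K {v : α →₀ K | ∃ a b, f a = f b ∧
          v = Finsupp.single a 1 - Finsupp.single b 1} := by
      intro w
      induction w using Finsupp.induction_linear with
      | zero => simp
      | add x y hx hy =>
        rw [Finsupp.mapDomain_add, add_sub_add_comm]
        exact add_mem hx hy
      | single a c =>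
        have h : Finsupp.single a c - Finsupp.single (Function.surjInv hf (f a)) c =
            c • (Finsupp.single a (1 : K) - Finsupp.single (Function.surjInv hf (f a)) 1) := by
          simp [smul_sub]
        rw [Finsupp.mapDomain_single, Function.comp_apply, h]
        exact Submodule.smul_mem _ _
          (Submodule.subset_span ⟨a, _, (Function.surjInv_eq hf _).symm, rfl⟩)
    have hv' : Finsupp.mapDomain f v = 0 := hv
    simpa [Finsupp.mapDomain_comp, hv'] using key v

theorem finrank_span_single_sub_single_add_card {K α β : Type*} [Field K] [Finite α]
    {f : α → β} (hf : Function.Surjective f) :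
    Module.finrank K (Submodule.span K {v : α →₀ K | ∃ a b, f a = f b ∧
      v = Finsupp.single a 1 - Finsupp.single b 1}) + Nat.card β = Nat.card α := by
  have := Fintype.ofFinite α
  have : Finite β := Finite.of_surjective f hf
  have := Fintype.ofFinite β
  have h := LinearMap.finrank_range_add_finrank_ker (Finsupp.lmapDomain K K f)
  rw [LinearMap.range_eq_top.2 (Finsupp.mapDomain_surjective hf), finrank_top,
    Module.finrank_finsupp_self, Module.finrank_finsupp_self] at h
  rw [span_single_sub_single_eq_ker hf, Nat.card_eq_fintype_card, Nat.card_eq_fintype_card]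
  omega

/-- Squares with at most one diagonal not labelled `1`, parametrized by the base, the edges and
either the diagonal `(1,3)` or a nontrivial diagonal `(2,4)`. -/
def squareOfSum {M : Type} [MulOneClass M] : M × M × M × M × (M ⊕ {x : M // x ≠ 1}) → Sq M
  | (a, b, c, d, .inl x) => ⟨a, b, c, d, x, 1⟩
  | (a, b, c, d, .inr x) => ⟨a, b, c, d, 1, x⟩

theorem squareOfSum_injective {M : Type} [MulOneClass M] :
    Function.Injective (squareOfSum (M := M)) := by
  rintro ⟨a, b, c, d, x | ⟨x, hx⟩⟩ ⟨a', b', c', d', y | ⟨y, hy⟩⟩ h <;>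
    simp_all [squareOfSum]
  exact hy h.2.2.2.2.2.symm

theorem range_squareOfSum {M : Type} [MulOneClass M] :
    Set.range (squareOfSum (M := M)) =
      Set.range fun t : (M × M × M) × (M × M × M) × Bool => ev t.1 t.2.1 t.2.2 := by
  ext s
  constructor
  · rintro ⟨⟨a, b, c, d, x | x⟩, rfl⟩
    · exact ⟨((a, x, d), (1, b, c), true), by simp [ev, squareOfSum]⟩
    · exact ⟨((a, b, x), (1, c, d), false), by simp [ev, squareOfSum]⟩
  · rintro ⟨⟨⟨a, b, c⟩, ⟨x, y, z⟩, _ | _⟩, rfl⟩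
    · by_cases h : c * x = 1
      · exact ⟨(a, b, y, z, .inl 1), by simp [ev, squareOfSum, h]⟩
      · exact ⟨(a, b, y, z, .inr ⟨c * x, h⟩), by simp [ev, squareOfSum]⟩
    · exact ⟨(a, y, z, c, .inl (b * x)), by simp [ev, squareOfSum]⟩

theorem card_range_ev {M : Type} [MulOneClass M] [Fintype M] :
    Nat.card (Set.range fun t : (M × M × M) × (M × M × M) × Bool => ev t.1 t.2.1 t.2.2) =
      Fintype.card M ^ 4 * (Fintype.card M + (Fintype.card M - 1)) := by
  classical
  rw [← range_squareOfSum, Nat.card_range_of_injective squareOfSum_injective,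
    Nat.card_eq_fintype_card]
  simp only [Fintype.card_prod, Fintype.card_sum, Fintype.card_subtype_compl,
    Fintype.card_subtype_eq, ne_eq]
  ring

/-- The dimension of the space of relations `R` (the span of all differences
`e(p,q,i) − e(p',q',i')` with equal evaluations) is `2m⁶ − 2m⁵ + m⁴`, where `m = #M`. -/
theorem statement5 (K : Type) [Field K] [CharZero K]
    (M : Type) [MulOneClass M] [Fintype M] :
    Module.finrank K ↥(Submodule.span K (evRelSet K M))
      = 2 * Fintype.card M ^ 6 - 2 * Fintype.card M ^ 5 + Fintype.card M ^ 4 := by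
  have h := finrank_span_single_sub_single_add_card (K := K) (Set.rangeFactorization_surjective
    (f := fun t : (M × M × M) × (M × M × M) × Bool => ev t.1 t.2.1 t.2.2))
  have hset : evRelSet K M = {v | ∃ a b : (M × M × M) × (M × M × M) × Bool,
      Set.rangeFactorization (fun t => ev t.1 t.2.1 t.2.2) a =
        Set.rangeFactorization (fun t => ev t.1 t.2.1 t.2.2) b ∧
      v = Finsupp.single a 1 - Finsupp.single b 1} := by
    ext v
    simp [evRelSet, e, Set.rangeFactorization, Prod.exists]
  rw [← hset, card_range_ev, Nat.card_eq_fintype_card] at h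
  simp only [Fintype.card_prod, Fintype.card_bool] at h
  obtain ⟨k, hk⟩ : ∃ k, Fintype.card M = k + 1 :=
    Nat.exists_eq_succ_of_ne_zero (Fintype.card_pos_iff.2 ⟨(1 : M)⟩).ne'
  rw [hk] at h ⊢
  have hle : 2 * (k + 1) ^ 5 ≤ 2 * (k + 1) ^ 6 := by gcongr <;> omega
  rw [Nat.add_sub_cancel] at h
  zify [hle] at h ⊢
  linear_combination h
end

section
/- Let K be a field of characteristic zero, M a unitary magma, and V the K-vector space with basis {e(p,q,i) : p ∈ M³, q ∈ M³, i ∈ {1,2}}. Then the subspace spanned by all differences e(p,q,i) − e(p',q',i') with ev(p,q,i) = ev(p',q',i') coincides with the subspace spanned by the following three explicit families of vectors, where p,q,r range over M³: (a) e(p,q,1) − e((p_0,r_1,p_2),(r_0,q_1,q_2),1) whenever p_1 ⋆ q_0 = r_1 ⋆ r_0 ≠ 1_M; (b) e(p,q,1) − e((p_0,q_1,r_2),(r_0,q_2,p_2),2) whenever p_1 ⋆ q_0 = r_2 ⋆ r_0 = 1_M; (c) e(p,q,2) − e((p_0,p_1,r_2),(r_0,q_1,q_2),2) whenever p_2 ⋆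 q_0 = r_2 ⋆ r_0 ≠ 1_M. -/
/-- Family (a): `e(p,q,1) − e((p₀,r₁,p₂),(r₀,q₁,q₂),1)` whenever
`p₁ ⋆ q₀ = r₁ ⋆ r₀ ≠ 1`. -/
def famA (K : Type) [Field K] (M : Type) [MulOneClass M] :
    Set (((M × M × M) × (M × M × M) × Bool) →₀ K) :=
  {v | ∃ p q r : M × M × M,
    p.2.1 * q.1 = r.2.1 * r.1 ∧ r.2.1 * r.1 ≠ 1 ∧
    v = e K p q true - e K (p.1, r.2.1, p.2.2) (r.1, q.2.1, q.2.2) true}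

/-- Family (b): `e(p,q,1) − e((p₀,q₁,r₂),(r₀,q₂,p₂),2)` whenever
`p₁ ⋆ q₀ = r₂ ⋆ r₀ = 1`. -/
def famB (K : Type) [Field K] (M : Type) [MulOneClass M] :
    Set (((M × M × M) × (M × M × M) × Bool) →₀ K) :=
  {v | ∃ p q r : M × M × M,
    p.2.1 * q.1 = 1 ∧ r.2.2 * r.1 = 1 ∧
    v = e K p q true - e K (p.1, q.2.1, r.2.2) (r.1, q.2.2, p.2.2) false}

/-- Family (c): `e(p,q,2) − e((p₀,p₁,r₂),(r₀,q₁,q₂),2)` whenever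
`p₂ ⋆ q₀ = r₂ ⋆ r₀ ≠ 1`. -/
def famC (K : Type) [Field K] (M : Type) [MulOneClass M] :
    Set (((M × M × M) × (M × M × M) × Bool) →₀ K) :=
  {v | ∃ p q r : M × M × M,
    p.2.2 * q.1 = r.2.2 * r.1 ∧ r.2.2 * r.1 ≠ 1 ∧
    v = e K p q false - e K (p.1, p.2.1, r.2.2) (r.1, q.2.1, q.2.2) false}

theorem sub_mem_span_of_ev_eq (K : Type) [Field K] {M : Type} [MulOneClass M]
    {p q p' q' : M × M × M} {i i' : Bool} (h : ev p q i = ev p' q' i') :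
    e K p q i - e K p' q' i' ∈ Submodule.span K (famA K M ∪ famB K M ∪ famC K M) := by
  have hA {v} (hv : v ∈ famA K M) : v ∈ Submodule.span K (famA K M ∪ famB K M ∪ famC K M) :=
    Submodule.subset_span (Or.inl (Or.inl hv))
  have hB {v} (hv : v ∈ famB K M) : v ∈ Submodule.span K (famA K M ∪ famB K M ∪ famC K M) :=
    Submodule.subset_span (Or.inl (Or.inr hv))
  have hC {v} (hv : v ∈ famC K M) : v ∈ Submodule.span K (famA K M ∪ famB K M ∪ famC K M) :=
    Submodule.subset_span (Or.inr hv)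
  obtain ⟨p0, p1, p2⟩ := p
  obtain ⟨q0, q1, q2⟩ := q
  obtain ⟨r0, r1, r2⟩ := p'
  obtain ⟨s0, s1, s2⟩ := q'
  cases i <;> cases i' <;> simp only [ev, Bool.false_eq_true, if_true, if_false, Sq.mk.injEq] at h
  · obtain ⟨rfl, rfl, rfl, rfl, -, h⟩ := h
    by_cases h1 : r2 * s0 = 1
    · rw [← sub_sub_sub_cancel_left (c := e K (p0, 1, q2) (1, p1, q1) true)]
      exact sub_mem (hB ⟨(p0, 1, q2), (1, p1, q1), (s0, 1, r2), mul_one 1, h1, rfl⟩)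
        (hB ⟨(p0, 1, q2), (1, p1, q1), (q0, 1, p2), mul_one 1, h.trans h1, rfl⟩)
    · exact hC ⟨(p0, p1, p2), (q0, q1, q2), (s0, 1, r2), h, h1, rfl⟩
  · obtain ⟨rfl, rfl, rfl, rfl, h1, h2⟩ := h
    rw [← neg_sub]
    exact neg_mem (hB ⟨(p0, r1, q2), (s0, p1, q1), (q0, 1, p2), h1.symm, h2, rfl⟩)
  · obtain ⟨rfl, rfl, rfl, rfl, h1, h2⟩ := h
    exact hB ⟨(p0, p1, p2), (q0, q1, q2), (s0, 1, r2), h1, h2.symm, rfl⟩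
  · obtain ⟨rfl, rfl, rfl, rfl, h, -⟩ := h
    by_cases h1 : r1 * s0 = 1
    · rw [← sub_sub_sub_cancel_right _ _ (e K (p0, q1, 1) (1, q2, p2) false)]
      exact sub_mem
        (hB ⟨(p0, p1, p2), (q0, q1, q2), (1, 1, 1), h.trans h1, mul_one 1, rfl⟩)
        (hB ⟨(p0, r1, p2), (s0, q1, q2), (1, 1, 1), h1, mul_one 1, rfl⟩)
    · exact hA ⟨(p0, p1, p2), (q0, q1, q2), (s0, r1, 1), h, h1, rfl⟩

/-- The span of all differences `e(p,q,i) − e(p',q',i')` with equal evaluations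
coincides with the span of the three explicit families (a), (b), (c). -/
theorem statement6 (K : Type) [Field K] [CharZero K] (M : Type) [MulOneClass M] :
    Submodule.span K (evRelSet K M)
      = Submodule.span K (famA K M ∪ famB K M ∪ famC K M) := by
  apply le_antisymm <;> rw [Submodule.span_le]
  · rintro _ ⟨p, q, i, p', q', i', h, rfl⟩
    exact sub_mem_span_of_ev_eq K h
  · rintro _ ((⟨p, q, r, h, -, rfl⟩ | ⟨p, q, r, h1, h2, rfl⟩) | ⟨p, q, r, h, -, rfl⟩) <;>
      refine Submodule.subset_span ⟨_, _, _, _, _, _, ?_, rfl⟩ <;> simp [ev, *]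
end

section
/- Let M be a unitary magma. The one-step rewrite relation ⇒ on binary trees with internal nodes labeled by M³ is terminating: there is no infinite sequence t ⇒ t_1 ⇒ t_2 ⇒ ⋯ (equivalently, the converse of ⇒ is a well-founded relation). -/
/-! Plane rooted binary trees with internal nodes labeled by `M`-triangles
(triples in `M³`), and the one-step rewrite relation `⇒` on them, for a unitary
magma `M` (modeled as `MulOneClass`). -/

/-- Binary trees with internal nodes labeled by `M³`. -/
inductive BT (M : Type) : Type
  | leaf : BT M
  | node : (M × M × M) → BT M → BT M → BT M

namespace BT

variable {M : Type} [MulOneClass M]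

/-- The one-step rewrite relation `⇒`: apply one of the rules (R1), (R2), (R3)
at any position inside a tree. -/
inductive Step : BT M → BT M → Prop
  | R1 (p q : M × M × M) (l1 l2 r : BT M) (h : q.1 ≠ 1) :
      Step (node p (node q l1 l2) r)
        (node (p.1, p.2.1 * q.1, p.2.2) (node (1, q.2.1, q.2.2) l1 l2) r)
  | R2 (p q : M × M × M) (l1 l2 r : BT M) (h : p.2.1 * q.1 = 1) :
      Step (node p (node q l1 l2) r)
        (node (p.1, q.2.1, 1) l1 (node (1, q.2.2, p.2.2) l2 r))
  | R3 (p q : M × M × M) (l r1 r2 : BT M) (h : q.1 ≠ 1) :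
      Step (node p l (node q r1 r2))
        (node (p.1, p.2.1, p.2.2 * q.1) l (node (1, q.2.1, q.2.2) r1 r2))
  | left (p : M × M × M) (l l' r : BT M) :
      Step l l' → Step (node p l r) (node p l' r)
  | right (p : M × M × M) (l r r' : BT M) :
      Step r r' → Step (node p l r) (node p l r')

end BT

namespace BT

/-- The number of internal nodes. -/
def size {M : Type} : BT M → ℕ
  | leaf => 0
  | node _ l r => l.size + r.size + 1

/-- The sum, over all internal nodes, of the size of the left subtree. -/
def leftWeight {M : Type} : BT M → ℕ
  | leaf => 0
  | node _ l r => l.leftWeight + r.leftWeight + l.size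

open Classical in
/-- The number of internal nodes whose label has a nontrivial first component. -/
noncomputable def nontrivialCount {M : Type} [MulOneClass M] : BT M → ℕ
  | leaf => 0
  | node p l r => l.nontrivialCount + r.nontrivialCount + if p.1 = 1 then 0 else 1

theorem Step.size_eq {M : Type} [MulOneClass M] {t t' : BT M} (h : Step t t') :
    t'.size = t.size := by
  induction h <;> simp only [size] <;> omega

/-- Rotations decrease `leftWeight`; the other rules keep it and decrease `nontrivialCount`. -/
theorem Step.lex_decrease {M : Type} [MulOneClass M] {t t' : BT M} (h : Step t t') :
    t'.leftWeight < t.leftWeight ∨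
      t'.leftWeight = t.leftWeight ∧ t'.nontrivialCount < t.nontrivialCount := by
  induction h with
  | R1 p q l1 l2 r h | R3 p q l r1 r2 h =>
    refine Or.inr ⟨rfl, ?_⟩
    simp only [nontrivialCount, if_neg h, if_true]
    omega
  | R2 p q l1 l2 r h =>
    left
    simp only [leftWeight, size]
    omega
  | left p l l' r h ih | right p l r r' h ih =>
    have := h.size_eq
    simp only [leftWeight, nontrivialCount]
    omega

end BT

/-- The rewrite relation `⇒` is terminating: there is no infinite sequence
`t ⇒ t₁ ⇒ t₂ ⇒ ⋯`; equivalently, the converse of `⇒` is well-founded. -/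
theorem statement7 (M : Type) [MulOneClass M] :
    WellFounded (fun t t' : BT M => BT.Step t' t) := by
  refine Subrelation.wf (fun {t t'} h => ?_)
    (InvImage.wf (fun t : BT M => (t.leftWeight, t.nontrivialCount))
      (WellFounded.prod_lex Nat.lt_wfRel.wf Nat.lt_wfRel.wf))
  exact Prod.lex_def.mpr h.lex_decrease
end

section
/- Let K be a field of characteristic zero, M a unitary magma, and A an M-compatible associative K-algebra. Then the binary operations ⊳_p, p ∈ M³, defined by a_1 ⊳_p a_2 := ω_{p_0}(ω_{p_1}(a_1) ⊙ ω_{p_2}(a_2)), satisfy the NC M relations (Rel1), (Rel2), (Rel3). -/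
/-- Let `A` be an `M`-compatible associative algebra over a field `K` of
characteristic zero: a (not necessarily unital) associative `K`-algebra together
with `K`-linear maps `ω_x : A → A` (`x ∈ M`) satisfying `ω_1 = id` and
`ω_x ∘ ω_y = ω_{x⋆y}`.  Then the binary operations
`a₁ ⊳_p a₂ := ω_{p₀}(ω_{p₁}(a₁) ⊙ ω_{p₂}(a₂))`, `p ∈ M³`, satisfy the
`NC M` relations (Rel1), (Rel2), (Rel3). -/
theorem statement11 (K : Type) [Field K] [CharZero K]
    (M : Type) [MulOneClass M]
    (A : Type) [NonUnitalRing A] [Module K A]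
    [SMulCommClass K A A] [IsScalarTower K A A]
    (ω : M → A →ₗ[K] A)
    (hone : ω 1 = LinearMap.id)
    (hcomp : ∀ x y : M, (ω x) ∘ₗ (ω y) = ω (x * y)) :
    let op : M × M × M → A → A → A := fun p a1 a2 => ω p.1 (ω p.2.1 a1 * ω p.2.2 a2)
    -- (Rel1)
    (∀ (p q r : M × M × M) (a1 a2 a3 : A),
      p.2.1 * q.1 = r.2.1 * r.1 → r.2.1 * r.1 ≠ 1 →
      op p (op q a1 a2) a3 = op (p.1, r.2.1, p.2.2) (op (r.1, q.2.1, q.2.2) a1 a2) a3) ∧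
    -- (Rel2)
    (∀ (p q r : M × M × M) (a1 a2 a3 : A),
      p.2.1 * q.1 = 1 → r.2.2 * r.1 = 1 →
      op p (op q a1 a2) a3 = op (p.1, q.2.1, r.2.2) a1 (op (r.1, q.2.2, p.2.2) a2 a3)) ∧
    -- (Rel3)
    (∀ (p q r : M × M × M) (a1 a2 a3 : A),
      p.2.2 * q.1 = r.2.2 * r.1 → r.2.2 * r.1 ≠ 1 →
      op p a1 (op q a2 a3) = op (p.1, p.2.1, r.2.2) a1 (op (r.1, q.2.1, q.2.2) a2 a3)) := by
  intro op
  have hω (x y : M) (a : A) : ω x (ω y a) = ω (x * y) a := LinearMap.congr_fun (hcomp x y) a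
  refine ⟨fun p q r a1 a2 a3 h _ => ?_, fun p q r a1 a2 a3 h h' => ?_,
    fun p q r a1 a2 a3 h _ => ?_⟩
  · simp only [op, hω p.2.1 q.1, hω r.2.1 r.1, h]
  · simp only [op, hω p.2.1 q.1, hω r.2.2 r.1, h, h', hone, LinearMap.id_apply, mul_assoc]
  · simp only [op, hω p.2.2 q.1, hω r.2.2 r.1, h]
end

section
/- Let K be a field of characteristic zero and M a monoid with operation ⋆ and unit 1_M. For x ∈ M let ω_x be the K-linear endomorphism of the monoid algebra K⟨M*⟩ of the free monoid over M sending each word w_1⋯w_k to (x⋆w_1)⋯(x⋆w_k). Then ω_{1_M} = id, ω_x ∘ ω_y = ω_{x⋆y} for all x,y ∈ M, and the binary operations f_1 ⊳_p f_2 := ω_{p_0}(ω_{p_1}(f_1)·ω_{p_2}(f_2)), p ∈ M³ (with · the concatenation product of K⟨M*⟩), satisfy the NC M relations (Rel1), (Rel2), (Rel3). -/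
theorem mapDomainAlgHom_map_one_mul_apply {K M : Type*} [CommSemiring K] [Monoid M]
    (f : MonoidAlgebra K (FreeMonoid M)) :
    MonoidAlgebra.mapDomainAlgHom K K (FreeMonoid.map fun y : M => 1 * y) f = f := by
  have h : (FreeMonoid.map fun y : M => 1 * y) = MonoidHom.id (FreeMonoid M) := by
    ext y
    simp
  rw [h, MonoidAlgebra.mapDomainAlgHom_id, AlgHom.id_apply]

theorem mapDomainAlgHom_map_mul_apply {K M : Type*} [CommSemiring K] [Monoid M] (x y : M)
    (f : MonoidAlgebra K (FreeMonoid M)) :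
    MonoidAlgebra.mapDomainAlgHom K K (FreeMonoid.map fun z => x * z)
        (MonoidAlgebra.mapDomainAlgHom K K (FreeMonoid.map fun z => y * z) f) =
      MonoidAlgebra.mapDomainAlgHom K K (FreeMonoid.map fun z => x * y * z) f := by
  have h : (FreeMonoid.map fun z => x * y * z) =
      (FreeMonoid.map fun z => x * z).comp (FreeMonoid.map fun z => y * z) := by
    ext z
    simp [mul_assoc]
  rw [h, MonoidAlgebra.mapDomainAlgHom_comp, AlgHom.comp_apply]


/-- Let `M` be a monoid and `K⟨M*⟩` the monoid algebra of the free monoid over `M`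
(noncommutative polynomials in the letters of `M` under concatenation), over a
field `K` of characteristic zero.  For `x ∈ M`, let `ω_x` be the `K`-linear
endomorphism sending a word `w₁⋯w_k` to `(x⋆w₁)⋯(x⋆w_k)`.  Then `ω_1 = id`,
`ω_x ∘ ω_y = ω_{x⋆y}`, and the operations
`f₁ ⊳_p f₂ := ω_{p₀}(ω_{p₁}(f₁)·ω_{p₂}(f₂))`, `p ∈ M³`, satisfy the `NC M`
relations (Rel1), (Rel2), (Rel3). -/
theorem statement12 (K : Type) [Field K] [CharZero K] (M : Type) [Monoid M] :
    let ω : M → MonoidAlgebra K (FreeMonoid M) →ₗ[K] MonoidAlgebra K (FreeMonoid M) :=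
      fun x => (MonoidAlgebra.mapDomainAlgHom K K
        (FreeMonoid.map fun y => x * y)).toLinearMap
    let op : M × M × M → MonoidAlgebra K (FreeMonoid M) →
        MonoidAlgebra K (FreeMonoid M) → MonoidAlgebra K (FreeMonoid M) :=
      fun p f1 f2 => ω p.1 (ω p.2.1 f1 * ω p.2.2 f2)
    (ω 1 = LinearMap.id) ∧
    (∀ x y : M, (ω x) ∘ₗ (ω y) = ω (x * y)) ∧
    -- (Rel1)
    (∀ (p q r : M × M × M) (f1 f2 f3 : MonoidAlgebra K (FreeMonoid M)),
      p.2.1 * q.1 = r.2.1 * r.1 → r.2.1 * r.1 ≠ 1 →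
      op p (op q f1 f2) f3 = op (p.1, r.2.1, p.2.2) (op (r.1, q.2.1, q.2.2) f1 f2) f3) ∧
    -- (Rel2)
    (∀ (p q r : M × M × M) (f1 f2 f3 : MonoidAlgebra K (FreeMonoid M)),
      p.2.1 * q.1 = 1 → r.2.2 * r.1 = 1 →
      op p (op q f1 f2) f3 = op (p.1, q.2.1, r.2.2) f1 (op (r.1, q.2.2, p.2.2) f2 f3)) ∧
    -- (Rel3)
    (∀ (p q r : M × M × M) (f1 f2 f3 : MonoidAlgebra K (FreeMonoid M)),
      p.2.2 * q.1 = r.2.2 * r.1 → r.2.2 * r.1 ≠ 1 →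
      op p f1 (op q f2 f3) = op (p.1, p.2.1, r.2.2) f1 (op (r.1, q.2.1, q.2.2) f2 f3)) := by
  intro ω op
  have hone : ω 1 = LinearMap.id :=
    LinearMap.ext mapDomainAlgHom_map_one_mul_apply
  have hcomp : ∀ (x y : M) (f : MonoidAlgebra K (FreeMonoid M)), ω x (ω y f) = ω (x * y) f :=
    mapDomainAlgHom_map_mul_apply
  have hmul : ∀ (x : M) (f g : MonoidAlgebra K (FreeMonoid M)), ω x (f * g) = ω x f * ω x g :=
    fun x => map_mul (MonoidAlgebra.mapDomainAlgHom K K (FreeMonoid.map fun y => x * y))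
  have hid : ∀ f : MonoidAlgebra K (FreeMonoid M), ω 1 f = f := fun f => by
    rw [hone, LinearMap.id_apply]
  refine ⟨hone, fun x y => LinearMap.ext (hcomp x y), ?_, ?_, ?_⟩
  · intro p q r f1 f2 f3 h _
    simp only [op]
    rw [hcomp p.2.1, hcomp r.2.1, h]
  · intro p q r f1 f2 f3 h h'
    simp only [op]
    rw [hcomp p.2.1, hcomp r.2.2, h, h', hid, hid, mul_assoc]
  · intro p q r f1 f2 f3 h _
    simp only [op]
    rw [hcomp p.2.2, hcomp r.2.2, h]
end

section
/- Let K be a field of characteristic zero, M a finite unitary magma, and V the K-vector space with basis {e(p,q,i) : p ∈ M³, q ∈ M³, i ∈ {1,2}}, equipped with the bilinear form ⟨·,·⟩ determined by ⟨e(p,q,i), e(p',q',i')⟩ = 1 if p = p', q = q' and i = i' = 1; = −1 if p = p', q = q' and i = i' = 2; and = 0 otherwise. Let R ⊆ V be the span of all differences e(p,q,i) − e(p',q',i') with ev(p,q,i) = ev(p',q',i'). Then the annihilator {v ∈ V : ⟨r,v⟩ = 0 for all r ∈ R} equals the span R^! of the following families: (a) for each (p_0,p_2,q_1,q_2) ∈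 M⁴ and each δ ∈ M ∖ {1_M}, the vector Σ e((p_0,p_1,p_2),(q_0,q_1,q_2),1) summed over all (p_1,q_0) ∈ M² with p_1 ⋆ q_0 = δ; (b) for each (p_0,p_2,q_1,q_2) ∈ M⁴, the vector Σ [e((p_0,p_1,p_2),(q_0,q_1,q_2),1) − e((p_0,q_1,p_1),(q_0,q_2,p_2),2)] summed over all (p_1,q_0) ∈ M² with p_1 ⋆ q_0 = 1_M; (c) for each (p_0,p_1,q_1,q_2) ∈ M⁴ and each δ ∈ M ∖ {1_M}, the vector Σ e((p_0,p_1,p_2),(q_0,q_1,q_2),2) summed over all (p_2,q_0) ∈ M² with p_2 ⋆ q_0 = δ. -/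
/-- The bilinear form on `V` determined by
`⟨e(p,q,i), e(p',q',i')⟩ = 1` if `p = p'`, `q = q'`, `i = i' = 1`,
`= −1` if `p = p'`, `q = q'`, `i = i' = 2`, and `= 0` otherwise. -/
def form (K : Type) [Field K] {M : Type}
    (u v : ((M × M × M) × (M × M × M) × Bool) →₀ K) : K :=
  u.sum fun x c => c * v x * (if x.2.2 then 1 else -1)

/-- Dual family (a). -/
noncomputable def dualA (K : Type) [Field K] (M : Type) [MulOneClass M] [Fintype M]
    [DecidableEq M] : Set (((M × M × M) × (M × M × M) × Bool) →₀ K) :=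
  {v | ∃ p0 p2 q1 q2 δ : M, δ ≠ 1 ∧
    v = ∑ x : M × M, if x.1 * x.2 = δ then e K (p0, x.1, p2) (x.2, q1, q2) true else 0}

/-- Dual family (b). -/
noncomputable def dualB (K : Type) [Field K] (M : Type) [MulOneClass M] [Fintype M]
    [DecidableEq M] : Set (((M × M × M) × (M × M × M) × Bool) →₀ K) :=
  {v | ∃ p0 p2 q1 q2 : M,
    v = ∑ x : M × M, if x.1 * x.2 = 1 then
      e K (p0, x.1, p2) (x.2, q1, q2) true - e K (p0, q1, x.1) (x.2, q2, p2) false else 0}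

/-- Dual family (c). -/
noncomputable def dualC (K : Type) [Field K] (M : Type) [MulOneClass M] [Fintype M]
    [DecidableEq M] : Set (((M × M × M) × (M × M × M) × Bool) →₀ K) :=
  {v | ∃ p0 p1 q1 q2 δ : M, δ ≠ 1 ∧
    v = ∑ x : M × M, if x.1 * x.2 = δ then e K (p0, p1, x.1) (x.2, q1, q2) false else 0}

/-- The index set of the basis of `V`. -/
abbrev TreeIndex (M : Type) : Type := (M × M × M) × (M × M × M) × Bool

/-- The evaluation of a basis index. -/
def evIndex {M : Type} [MulOneClass M] (x : TreeIndex M) : Sq M := ev x.1 x.2.1 x.2.2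

/-- The sign `⟨e x, e x⟩` of a basis index. -/
def indexSign (K : Type) [Field K] {M : Type} (x : TreeIndex M) : K :=
  if x.2.2 then 1 else -1

open scoped Classical in
/-- The signed sum of all basis vectors whose evaluation is the clique `s`. -/
noncomputable def fiberVec (K : Type) [Field K] {M : Type} [MulOneClass M] [Fintype M]
    (s : Sq M) : TreeIndex M →₀ K :=
  Finsupp.equivFunOnFinite.symm fun x => if evIndex x = s then indexSign K x else 0

open scoped Classical in
theorem fiberVec_apply (K : Type) [Field K] {M : Type} [MulOneClass M] [Fintype M]
    (s : Sq M) (x : TreeIndex M) :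
    fiberVec K s x = if evIndex x = s then indexSign K x else 0 :=
  rfl

theorem indexSign_mul_self (K : Type) [Field K] {M : Type} (x : TreeIndex M) :
    indexSign K x * indexSign K x = 1 := by
  unfold indexSign; split_ifs <;> ring

theorem form_add_left (K : Type) [Field K] {M : Type} (u w v : TreeIndex M →₀ K) :
    form K (u + w) v = form K u v + form K w v := by
  classical
  exact Finsupp.sum_add_index' (fun _ => by ring) fun _ _ _ => by ring

theorem form_smul_left (K : Type) [Field K] {M : Type} (a : K) (u v : TreeIndex M →₀ K) :
    form K (a • u) v = a * form K u v := by
  unfold form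
  rw [Finsupp.sum_smul_index' fun _ => by ring, Finsupp.mul_sum]
  simp only [smul_eq_mul, mul_assoc]

theorem form_e_sub_e (K : Type) [Field K] {M : Type} (x y : TreeIndex M)
    (v : TreeIndex M →₀ K) :
    form K (e K x.1 x.2.1 x.2.2 - e K y.1 y.2.1 y.2.2) v
      = indexSign K x * v x - indexSign K y * v y := by
  classical
  unfold form e indexSign
  rw [Finsupp.sum_sub_index fun _ _ _ => by ring, Finsupp.sum_single_index (by ring),
    Finsupp.sum_single_index (by ring)]
  ring

/-- A vector is orthogonal to the relations iff its signed coordinates are constant on the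
fibers of the evaluation. -/
theorem forall_form_eq_zero_iff (K : Type) [Field K] {M : Type} [MulOneClass M]
    (v : TreeIndex M →₀ K) :
    (∀ r ∈ Submodule.span K (evRelSet K M), form K r v = 0) ↔
      Function.FactorsThrough (fun x => indexSign K x * v x) (evIndex (M := M)) := by
  constructor
  · intro h x y hxy
    refine sub_eq_zero.1 ((form_e_sub_e K x y v).symm.trans (h _ (Submodule.subset_span ?_)))
    exact ⟨_, _, _, _, _, _, hxy, rfl⟩
  · intro h r hr
    induction hr using Submodule.span_induction with
    | mem r hr =>
      obtain ⟨p, q, i, p', q', i', hev, rfl⟩ := hr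
      exact (form_e_sub_e K (p, q, i) (p', q', i') v).trans (sub_eq_zero.2 (h hev))
    | zero => exact Finsupp.sum_zero_index
    | add r s _ _ hr hs => rw [form_add_left, hr, hs, add_zero]
    | smul a r _ hr => rw [form_smul_left, hr, mul_zero]

/-- The signed fiber sums span the vectors with signed coordinates constant on fibers. -/
theorem mem_span_fiberVec_iff (K : Type) [Field K] {M : Type} [MulOneClass M] [Fintype M]
    (v : TreeIndex M →₀ K) :
    v ∈ Submodule.span K (Set.range fun x : TreeIndex M => fiberVec K (evIndex x)) ↔
      Function.FactorsThrough (fun x => indexSign K x * v x) (evIndex (M := M)) := by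
  classical
  constructor
  · intro hv
    induction hv using Submodule.span_induction with
    | mem v hv =>
      obtain ⟨z, rfl⟩ := hv
      intro x y hxy
      simp only [fiberVec_apply, hxy, mul_ite, indexSign_mul_self, mul_zero]
    | zero => intro x y _; simp
    | add v w _ _ hv hw =>
      intro x y hxy
      simpa only [Finsupp.add_apply, mul_add] using congrArg₂ (· + ·) (hv hxy) (hw hxy)
    | smul a v _ hv =>
      intro x y hxy
      simpa only [Finsupp.smul_apply, smul_eq_mul, mul_left_comm] using
        congrArg (a * ·) (hv hxy)
  · intro hv
    have key : v = ∑ s ∈ Finset.univ.image (evIndex (M := M)),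
        Function.extend evIndex (fun x => indexSign K x * v x) 0 s • fiberVec K s := by
      ext x
      simp [Finsupp.finsetSum_apply, fiberVec_apply, hv.extend_apply, mul_right_comm,
        indexSign_mul_self]
    rw [key]
    refine Submodule.sum_mem _ fun s hs => Submodule.smul_mem _ _ (Submodule.subset_span ?_)
    obtain ⟨x, -, rfl⟩ := Finset.mem_image.1 hs
    exact ⟨x, rfl⟩

section Families

variable (K : Type) [Field K] {M : Type} [MulOneClass M] [Fintype M] [DecidableEq M]

theorem sum_e_true_eq_fiberVec (p0 p2 q1 q2 δ : M) (hδ : δ ≠ 1) :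
    (∑ x : M × M, if x.1 * x.2 = δ then e K (p0, x.1, p2) (x.2, q1, q2) true else 0)
      = fiberVec K ⟨p0, q1, q2, p2, δ, 1⟩ := by
  ext ⟨⟨a0, a1, a2⟩, ⟨b0, b1, b2⟩, i⟩
  rw [Finsupp.finsetSum_apply, fiberVec_apply]
  cases i
  · rw [Finset.sum_eq_zero]
    · simp [evIndex, ev, hδ.symm]
    · rintro ⟨u, w⟩ -
      dsimp only
      split_ifs <;> simp [e]
  · rw [Finset.sum_eq_single (a1, b0)]
    · simp only [evIndex, ev, e, indexSign]
      grind
    · rintro ⟨u, w⟩ - huw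
      dsimp only
      split_ifs <;> simp [e, Finsupp.single_apply]
      grind
    · simp

theorem sum_e_false_eq_fiberVec (p0 p1 q1 q2 δ : M) (hδ : δ ≠ 1) :
    (∑ x : M × M, if x.1 * x.2 = δ then e K (p0, p1, x.1) (x.2, q1, q2) false else 0)
      = -fiberVec K ⟨p0, p1, q1, q2, 1, δ⟩ := by
  ext ⟨⟨a0, a1, a2⟩, ⟨b0, b1, b2⟩, i⟩
  rw [Finsupp.finsetSum_apply, Finsupp.neg_apply, fiberVec_apply]
  cases i
  · rw [Finset.sum_eq_single (a2, b0)]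
    · simp only [evIndex, ev, e, indexSign]
      grind
    · rintro ⟨u, w⟩ - huw
      dsimp only
      split_ifs <;> simp [e, Finsupp.single_apply]
      grind
    · simp
  · rw [Finset.sum_eq_zero]
    · simp [evIndex, ev, hδ.symm]
    · rintro ⟨u, w⟩ -
      dsimp only
      split_ifs <;> simp [e]

theorem sum_e_sub_e_eq_fiberVec (p0 p2 q1 q2 : M) :
    (∑ x : M × M, if x.1 * x.2 = 1 then
      e K (p0, x.1, p2) (x.2, q1, q2) true - e K (p0, q1, x.1) (x.2, q2, p2) false else 0)
      = fiberVec K ⟨p0, q1, q2, p2, 1, 1⟩ := by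
  ext ⟨⟨a0, a1, a2⟩, ⟨b0, b1, b2⟩, i⟩
  rw [Finsupp.finsetSum_apply, fiberVec_apply]
  cases i
  · rw [Finset.sum_eq_single (a2, b0)]
    · simp only [evIndex, ev, e, indexSign]
      split_ifs <;> simp [Finsupp.single_apply] <;> grind
    · rintro ⟨u, w⟩ - huw
      dsimp only
      split_ifs <;> simp [e, Finsupp.single_apply]
      grind
    · simp
  · rw [Finset.sum_eq_single (a1, b0)]
    · simp only [evIndex, ev, e, indexSign]
      split_ifs <;> simp [Finsupp.single_apply] <;> grind
    · rintro ⟨u, w⟩ - huw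
      dsimp only
      split_ifs <;> simp [e, Finsupp.single_apply]
      grind
    · simp

variable (M) in
/-- The dual families span the same space as the signed fiber sums of the evaluation. -/
theorem span_dual_eq_span_fiberVec :
    Submodule.span K (dualA K M ∪ dualB K M ∪ dualC K M)
      = Submodule.span K (Set.range fun x : TreeIndex M => fiberVec K (evIndex x)) := by
  apply le_antisymm <;> rw [Submodule.span_le]
  · rintro v ((⟨p0, p2, q1, q2, δ, hδ, rfl⟩ | ⟨p0, p2, q1, q2, rfl⟩) |
      ⟨p0, p1, q1, q2, δ, hδ, rfl⟩)
    · rw [sum_e_true_eq_fiberVec K _ _ _ _ _ hδ]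
      exact Submodule.subset_span
        ⟨((p0, δ, p2), (1, q1, q2), true), by simp [evIndex, ev]⟩
    · rw [sum_e_sub_e_eq_fiberVec]
      exact Submodule.subset_span
        ⟨((p0, 1, p2), (1, q1, q2), true), by simp [evIndex, ev]⟩
    · rw [sum_e_false_eq_fiberVec K _ _ _ _ _ hδ]
      exact neg_mem (Submodule.subset_span
        ⟨((p0, p1, δ), (1, q1, q2), false), by simp [evIndex, ev]⟩)
  · rintro _ ⟨⟨⟨a0, a1, a2⟩, ⟨b0, b1, b2⟩, i⟩, rfl⟩
    cases i
    · by_cases h : a2 * b0 = 1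
      · refine Submodule.subset_span (Or.inl (Or.inr ⟨a0, b2, a1, b1, ?_⟩))
        rw [sum_e_sub_e_eq_fiberVec]
        simp [evIndex, ev, h]
      · rw [SetLike.mem_coe, ← neg_mem_iff]
        refine Submodule.subset_span (Or.inr ⟨a0, a1, b1, b2, a2 * b0, h, ?_⟩)
        rw [sum_e_false_eq_fiberVec K _ _ _ _ _ h]
        simp [evIndex, ev]
    · by_cases h : a1 * b0 = 1
      · refine Submodule.subset_span (Or.inl (Or.inr ⟨a0, a2, b1, b2, ?_⟩))
        rw [sum_e_sub_e_eq_fiberVec]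
        simp [evIndex, ev, h]
      · refine Submodule.subset_span (Or.inl (Or.inl ⟨a0, a2, b1, b2, a1 * b0, h, ?_⟩))
        rw [sum_e_true_eq_fiberVec K _ _ _ _ _ h]
        simp [evIndex, ev]

end Families

/-- The annihilator of the space of relations `R` with respect to the bilinear form
is the span of the three explicit dual families (a), (b), (c). -/
theorem statement13 (K : Type) [Field K] [CharZero K]
    (M : Type) [MulOneClass M] [Fintype M] [DecidableEq M] :
    {v : ((M × M × M) × (M × M × M) × Bool) →₀ K |
        ∀ r ∈ Submodule.span K (evRelSet K M), form K r v = 0}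
      = ↑(Submodule.span K (dualA K M ∪ dualB K M ∪ dualC K M)) := by
  ext v
  rw [Set.mem_ofPred_eq, forall_form_eq_zero_iff, SetLike.mem_coe, span_dual_eq_span_fiberVec,
    mem_span_fiberVec_iff]
end

section
/- Let K be a field of characteristic zero, M a finite unitary magma with m := #M, and V the K-vector space with basis {e(p,q,i) : p ∈ M³, q ∈ M³, i ∈ {1,2}}. Let R^! ⊆ V be the span of the families: (a) for each (p_0,p_2,q_1,q_2) ∈ M⁴ and each δ ∈ M ∖ {1_M}, the vector Σ e((p_0,p_1,p_2),(q_0,q_1,q_2),1) summed over all (p_1,q_0) ∈ M² with p_1 ⋆ q_0 = δ; (b) for each (p_0,p_2,q_1,q_2) ∈ M⁴, the vector Σ [e((p_0,p_1,p_2),(q_0,q_1,q_2),1) − e((p_0,q_1,p_1),(q_0,q_2,p_2),2)] summed over all (p_1,q_0) ∈ M² with p_1 ⋆ q_0 = 1_M; (c) for each (p_0,p_1,q_1,q_2) ∈ M⁴ and each δ ∈ M ∖ {1_M}, the vector Σ e((p_0,p_1,p_2),(q_0,q_1,q_2),2) summed over all (p_2,q_0) ∈ M² with p_2 ⋆ q_0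 = δ. Then dim R^! = 2m⁵ − m⁴. -/
/-- The sum of the basis vectors `e(p,q,1)` whose evaluation is the square with base `p0`,
edges `q1, q2, p2` and diagonal `(1,3)` labeled `δ`. -/
noncomputable def fiberLeft (K : Type) [Field K] {M : Type} [MulOneClass M] [Fintype M]
    [DecidableEq M] (p0 p2 q1 q2 δ : M) : ((M × M × M) × (M × M × M) × Bool) →₀ K :=
  ∑ x : M × M, if x.1 * x.2 = δ then e K (p0, x.1, p2) (x.2, q1, q2) true else 0

/-- The sum of the basis vectors `e(p,q,2)` whose evaluation is the square with base `p0`,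
edges `p1, q1, q2` and diagonal `(2,4)` labeled `δ`. -/
noncomputable def fiberRight (K : Type) [Field K] {M : Type} [MulOneClass M] [Fintype M]
    [DecidableEq M] (p0 p1 q1 q2 δ : M) : ((M × M × M) × (M × M × M) × Bool) →₀ K :=
  ∑ x : M × M, if x.1 * x.2 = δ then e K (p0, p1, x.1) (x.2, q1, q2) false else 0

/-- The three dual families gathered into one: `Sum.inl δ` gives the family (a) for `δ ≠ 1`
and the family (b) for `δ = 1`, while `Sum.inr δ` gives the family (c). -/
noncomputable def dualVector (K : Type) [Field K] {M : Type} [MulOneClass M] [Fintype M]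
    [DecidableEq M] :
    (M × M × M × M) × (M ⊕ {δ : M // δ ≠ 1}) → ((M × M × M) × (M × M × M) × Bool) →₀ K
  | ((p0, p2, q1, q2), .inl δ) =>
    fiberLeft K p0 p2 q1 q2 δ - if δ = 1 then fiberRight K p0 q1 q2 p2 1 else 0
  | ((p0, p1, q1, q2), .inr δ) => fiberRight K p0 p1 q1 q2 δ

/-- A basis element of `V` that occurs in `dualVector K i` and in no other `dualVector K j`. -/
def dualPivot {M : Type} [MulOneClass M] :
    (M × M × M × M) × (M ⊕ {δ : M // δ ≠ 1}) → (M × M × M) × (M × M × M) × Bool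
  | ((p0, p2, q1, q2), .inl δ) => ((p0, δ, p2), (1, q1, q2), true)
  | ((p0, p1, q1, q2), .inr δ) => ((p0, p1, δ), (1, q1, q2), false)

section

variable (K : Type) [Field K] {M : Type} [MulOneClass M] [Fintype M] [DecidableEq M]

lemma fiberLeft_apply (p0 p2 q1 q2 δ p0' p2' q1' q2' δ' : M) (i : Bool) :
    fiberLeft K p0 p2 q1 q2 δ ((p0', δ', p2'), (1, q1', q2'), i) =
      if p0 = p0' ∧ p2 = p2' ∧ q1 = q1' ∧ q2 = q2' ∧ δ = δ' ∧ i = true then 1 else 0 := by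
  rw [fiberLeft, Finsupp.finsetSum_apply, Fintype.sum_eq_single (δ', 1)]
  · simp only [mul_one, e]
    split_ifs <;> grind
  · rintro ⟨a, b⟩ h
    simp only [e]
    split_ifs <;> grind

lemma fiberRight_apply (p0 p1 q1 q2 δ p0' p1' q1' q2' δ' : M) (i : Bool) :
    fiberRight K p0 p1 q1 q2 δ ((p0', p1', δ'), (1, q1', q2'), i) =
      if p0 = p0' ∧ p1 = p1' ∧ q1 = q1' ∧ q2 = q2' ∧ δ = δ' ∧ i = false then 1 else 0 := by
  rw [fiberRight, Finsupp.finsetSum_apply, Fintype.sum_eq_single (δ', 1)]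
  · simp only [mul_one, e]
    split_ifs <;> grind
  · rintro ⟨a, b⟩ h
    simp only [e]
    split_ifs <;> grind

lemma dualVector_apply_dualPivot (i j : (M × M × M × M) × (M ⊕ {δ : M // δ ≠ 1})) :
    dualVector K j (dualPivot i) = if j = i then 1 else 0 := by
  obtain ⟨⟨a, b, c, d⟩, δ | δ⟩ := i <;> obtain ⟨⟨a', b', c', d'⟩, δ' | δ'⟩ := j <;>
    simp only [dualVector, dualPivot, Finsupp.sub_apply, fiberLeft_apply, fiberRight_apply] <;>
    split_ifs <;> grind [fiberRight_apply]

lemma linearIndependent_dualVector : LinearIndependent K (dualVector K (M := M)) := by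
  refine LinearIndependent.of_pairwise_dual_eq_zero_one _
    (fun i => Finsupp.lapply (dualPivot i)) (fun i j h => ?_) (fun i => ?_)
  · simp [dualVector_apply_dualPivot, h.symm]
  · simp [dualVector_apply_dualPivot]

lemma range_dualVector :
    Set.range (dualVector K (M := M)) = dualA K M ∪ dualB K M ∪ dualC K M := by
  have hB (p0 p2 q1 q2 : M) : (∑ x : M × M, if x.1 * x.2 = 1 then
      e K (p0, x.1, p2) (x.2, q1, q2) true - e K (p0, q1, x.1) (x.2, q2, p2) false else 0) =
      dualVector K ((p0, p2, q1, q2), .inl 1) := by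
    simp only [dualVector, fiberLeft, fiberRight, if_true, ← Finset.sum_sub_distrib]
    exact Finset.sum_congr rfl fun x _ => by split_ifs <;> simp
  ext v
  constructor
  · rintro ⟨⟨⟨a, b, c, d⟩, δ | δ⟩, rfl⟩
    · by_cases hδ : δ = 1
      · subst hδ
        exact .inl (.inr ⟨a, b, c, d, (hB a b c d).symm⟩)
      · exact .inl (.inl ⟨a, b, c, d, δ, hδ, by simp [dualVector, fiberLeft, hδ]⟩)
    · exact .inr ⟨a, b, c, d, δ, δ.2, rfl⟩
  · rintro ((⟨a, b, c, d, δ, hδ, rfl⟩ | ⟨a, b, c, d, rfl⟩) | ⟨a, b, c, d, δ, hδ, rfl⟩)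
    · exact ⟨((a, b, c, d), .inl δ), by simp [dualVector, fiberLeft, hδ]⟩
    · exact ⟨_, (hB a b c d).symm⟩
    · exact ⟨((a, b, c, d), .inr ⟨δ, hδ⟩), rfl⟩

end

/-- The dimension of the span of the three dual families is `2m⁵ − m⁴`, where `m = #M`. -/
theorem statement14 (K : Type) [Field K] [CharZero K]
    (M : Type) [MulOneClass M] [Fintype M] [DecidableEq M] :
    Module.finrank K ↥(Submodule.span K (dualA K M ∪ dualB K M ∪ dualC K M))
      = 2 * Fintype.card M ^ 5 - Fintype.card M ^ 4 := by
  rw [← range_dualVector, finrank_span_eq_card (linearIndependent_dualVector K)]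
  simp only [Fintype.card_prod, Fintype.card_sum, Fintype.card_subtype_compl,
    Fintype.card_subtype_eq]
  obtain ⟨n, hn⟩ := Nat.exists_eq_succ_of_ne_zero (Fintype.card_ne_zero (α := M))
  rw [hn, eq_tsub_iff_add_eq_of_le]
  · simp only [Nat.succ_eq_add_one, Nat.add_sub_cancel]
    ring
  · calc (n + 1) ^ 4 ≤ (n + 1) ^ 5 := Nat.pow_le_pow_right n.succ_pos (by norm_num)
      _ ≤ 2 * (n + 1) ^ 5 := by omega
end
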